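/- Let p be a prime, k a nonnegative integer, and c > 1 a real constant; set α_n = c·(log n)/n. Suppose that for every n ≥ 2 and every k',l' ∈ {1,…,n}, q^{(n)}_{k'l'} is an α_n-balanced probability mass function on F_p, and let P_n denote the induced probability on M_n(F_p). Then lim_{n→∞} Σ_{M ∈ M_n(F_p), rank(M) = n−k} P_n(M) = p^{−k²}·(∏_{j=1}^∞ (1 − p^{−j}))/(∏_{j=1}^k (1 − p^{−j}))². -/

import Mathlib

namespace RankUniv
open Finset

/-- Fourier coefficient of a function on `F_p`. -/
noncomputable def phi {p : ℕ} [Fact p.Prime] (r : ZMod p → ℝ) (a : ZMod p) : ℂ :=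
  ∑ x : ZMod p, (r x : ℂ) * ZMod.stdAddChar (x * a)

/-- The defect `1 - |phi|^2`. -/
noncomputable def dd {p : ℕ} [Fact p.Prime] (r : ZMod p → ℝ) (a : ZMod p) : ℝ :=
  1 - ‖phi r a‖ ^ 2

lemma map_sum_prod {p : ℕ} [Fact p.Prime] {J : Type*} (T : Finset J) (f : J → ZMod p) :
    (ZMod.stdAddChar (∑ j ∈ T, f j) : ℂ) = ∏ j ∈ T, (ZMod.stdAddChar (f j) : ℂ) := by
  classical
  induction T using Finset.induction_on with
  | empty => simp
  | insert a T ha ih => rw [sum_insert ha, prod_insert ha, AddChar.map_add_eq_mul, ih]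

lemma dd_eq {p : ℕ} [Fact p.Prime] (r : ZMod p → ℝ) (h1 : ∑ a, r a = 1) (a : ZMod p) :
    dd r a = ∑ x, ∑ y, r x * r y * (1 - (ZMod.stdAddChar ((x - y) * a) : ℂ).re) := by
  have h : ((‖phi r a‖ ^ 2 : ℝ) : ℂ)
      = ∑ x, ∑ y, (r x : ℂ) * r y * ZMod.stdAddChar ((x - y) * a) := by
    push_cast
    rw [← Complex.mul_conj', phi, map_sum, Finset.sum_mul_sum]
    refine sum_congr rfl fun x _ => sum_congr rfl fun y _ => ?_
    rw [map_mul (starRingEnd ℂ), Complex.conj_ofReal, sub_mul, sub_eq_add_neg, AddChar.map_add_eq_mul,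
      ← AddChar.map_neg_eq_conj]
    ring
  have h2 := congrArg Complex.re h
  rw [Complex.ofReal_re] at h2
  have h3 : ∑ x, ∑ y, r x * r y = 1 := by
    rw [← Finset.sum_mul_sum, h1, one_mul]
  rw [dd, h2]
  nth_rewrite 1 [← h3]
  simp only [Complex.re_sum, ← sum_sub_distrib]
  refine sum_congr rfl fun x _ => sum_congr rfl fun y _ => ?_
  rw [mul_assoc, Complex.re_ofReal_mul, Complex.re_ofReal_mul]
  ring

lemma re_le {p : ℕ} [Fact p.Prime] (b : ZMod p) : (ZMod.stdAddChar b : ℂ).re ≤ 1 := by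
  refine (Complex.re_le_norm _).trans ?_
  rw [AddChar.norm_apply]

lemma neg_le_re {p : ℕ} [Fact p.Prime] (b : ZMod p) : -1 ≤ (ZMod.stdAddChar b : ℂ).re := by
  have := Complex.abs_re_le_norm (ZMod.stdAddChar b : ℂ)
  rw [AddChar.norm_apply] at this
  exact (abs_le.1 this).1

lemma dd_nonneg {p : ℕ} [Fact p.Prime] (r : ZMod p → ℝ) (h0 : ∀ a, 0 ≤ r a)
    (h1 : ∑ a, r a = 1) (a : ZMod p) : 0 ≤ dd r a := by
  rw [dd_eq r h1]
  refine sum_nonneg fun x _ => sum_nonneg fun y _ => ?_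
  have := re_le ((x - y) * a)
  exact mul_nonneg (mul_nonneg (h0 _) (h0 _)) (by linarith)

lemma offdiag {p : ℕ} [Fact p.Prime] (r : ZMod p → ℝ) (h1 : ∑ a, r a = 1) :
    ∑ x, ∑ y, r x * r y * (if x = y then 0 else 1) = 1 - ∑ x, r x ^ 2 := by
  have h3 : ∑ x, ∑ y, r x * r y = 1 := by
    rw [← Finset.sum_mul_sum, h1, one_mul]
  nth_rewrite 2 [← h3]
  rw [← sum_sub_distrib]
  refine sum_congr rfl fun x _ => ?_
  have : ∀ y, r x * r y * (if x = y then (0:ℝ) else 1)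
      = r x * r y - (if x = y then r x * r y else 0) := by
    intro y; split_ifs <;> ring
  simp only [this, sum_sub_distrib]
  simp [sq]

lemma dd_le {p : ℕ} [Fact p.Prime] (r : ZMod p → ℝ) (h0 : ∀ a, 0 ≤ r a)
    (h1 : ∑ a, r a = 1) (a : ZMod p) : dd r a ≤ 2 * (1 - ∑ x, r x ^ 2) := by
  rw [dd_eq r h1, ← offdiag r h1, mul_sum]
  refine sum_le_sum fun x _ => ?_
  rw [mul_sum]
  refine sum_le_sum fun y _ => ?_
  have hn := mul_nonneg (h0 x) (h0 y)
  split_ifs with h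
  · subst h; simp
  · have := neg_le_re ((x - y) * a)
    nlinarith

/-- A uniform lower bound for `1 - Re ψ(b)`. -/
lemma exists_kappa (p : ℕ) [Fact p.Prime] : ∃ κ : ℝ, 0 < κ ∧
    ∀ b : ZMod p, b ≠ 0 → κ ≤ 1 - (ZMod.stdAddChar b : ℂ).re := by
  have hne : ((univ : Finset (ZMod p)).erase 0).Nonempty := ⟨1, by simp⟩
  obtain ⟨b0, hb0, hmin⟩ := exists_min_image _
    (fun b : ZMod p => 1 - (ZMod.stdAddChar b : ℂ).re) hne
  refine ⟨_, ?_, fun b hb => hmin b (by simp [hb])⟩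
  have hb : b0 ≠ 0 := by simpa using hb0
  rcases lt_or_eq_of_le (re_le b0) with h | h
  · linarith
  · exfalso
    have hn : ‖(ZMod.stdAddChar b0 : ℂ)‖ = 1 := AddChar.norm_apply _ _
    have : (ZMod.stdAddChar b0 : ℂ) = 1 := by
      have h2 := Complex.sq_norm (ZMod.stdAddChar b0 : ℂ)
      rw [hn, Complex.normSq_apply, h] at h2
      apply Complex.ext
      · simpa using h
      · simp; nlinarith
    have hinj := ZMod.injective_stdAddChar (N := p)
    exact hb (hinj (by rw [this, AddChar.map_zero_eq_one]))

lemma le_dd {p : ℕ} [Fact p.Prime] (r : ZMod p → ℝ) (h0 : ∀ a, 0 ≤ r a)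
    (h1 : ∑ a, r a = 1) (κ : ℝ)
    (hκ : ∀ b : ZMod p, b ≠ 0 → κ ≤ 1 - (ZMod.stdAddChar b : ℂ).re)
    (a : ZMod p) (ha : a ≠ 0) : κ * (1 - ∑ x, r x ^ 2) ≤ dd r a := by
  rw [dd_eq r h1, ← offdiag r h1, mul_sum]
  refine sum_le_sum fun x _ => ?_
  rw [mul_sum]
  refine sum_le_sum fun y _ => ?_
  have hn := mul_nonneg (h0 x) (h0 y)
  split_ifs with h
  · subst h; simp
  · have := hκ ((x - y) * a) (mul_ne_zero (sub_ne_zero.2 h) ha)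
    nlinarith

lemma sum_dd {p : ℕ} [Fact p.Prime] (r : ZMod p → ℝ) (h1 : ∑ a, r a = 1) :
    ∑ a, dd r a = p * (1 - ∑ x, r x ^ 2) := by
  simp only [dd_eq r h1]
  rw [sum_comm, ← offdiag r h1, mul_sum]
  refine sum_congr rfl fun x _ => ?_
  rw [sum_comm, mul_sum]
  refine sum_congr rfl fun y _ => ?_
  rw [← mul_sum, sum_sub_distrib]
  have h := AddChar.sum_mulShift (R' := ℂ) (x - y) (ZMod.isPrimitive_stdAddChar p)
  have h2 := congrArg Complex.re h
  rw [Complex.re_sum] at h2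
  simp only [mul_comm _ (x - y)] at h2
  rw [h2]
  simp only [sum_const, card_univ, ZMod.card, nsmul_eq_mul, mul_one, sub_eq_zero]
  split_ifs <;> simp [mul_comm]

lemma S_ge {p : ℕ} [Fact p.Prime] (r : ZMod p → ℝ) (h0 : ∀ a, 0 ≤ r a)
    (h1 : ∑ a, r a = 1) (α : ℝ) (hα : α ≤ 1 / 2) (hb : ∀ a, r a ≤ 1 - α) :
    2 * α * (1 - α) ≤ 1 - ∑ x, r x ^ 2 := by
  obtain ⟨x0, -, hmax⟩ := exists_max_image (univ : Finset (ZMod p)) r ⟨0, mem_univ _⟩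
  have hle : ∑ x, r x ^ 2 ≤ r x0 := by
    calc ∑ x, r x ^ 2 ≤ ∑ x, r x0 * r x := by
          refine sum_le_sum fun x hx => ?_
          have := hmax x hx
          nlinarith [h0 x]
      _ = r x0 := by rw [← mul_sum, h1, mul_one]
  by_cases hM : r x0 < 1 / 2
  · nlinarith [sq_nonneg (1 - 2 * α)]
  · have hs : ∑ x ∈ univ.erase x0, r x = 1 - r x0 := by
      rw [← h1, ← add_sum_erase _ _ (mem_univ x0)]; ring
    have h2 : ∑ x ∈ univ.erase x0, r x ^ 2 ≤ (1 - r x0) ^ 2 := by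
      rw [← hs]
      exact sum_sq_le_sq_sum_of_nonneg fun i _ => h0 i
    rw [← add_sum_erase _ _ (mem_univ x0)]
    have := hb x0
    nlinarith

lemma exp_neg_le (z : ℝ) (hz : 0 ≤ z) : Real.exp (-z) ≤ 1 - z + z ^ 2 / 2 := by
  have h := Real.quadratic_le_exp_of_nonneg hz
  rw [Real.exp_neg]
  have h3 : 0 < 1 - z + z ^ 2 / 2 := by nlinarith [sq_nonneg (z - 1)]
  rw [inv_le_iff_one_le_mul₀ (Real.exp_pos z)]
  nlinarith [mul_le_mul_of_nonneg_left h h3.le, sq_nonneg (z ^ 2)]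

lemma sum_exp_dd {p : ℕ} [Fact p.Prime] (r : ZMod p → ℝ) (h0 : ∀ a, 0 ≤ r a)
    (h1 : ∑ a, r a = 1) (S0 : ℝ) (hS0 : 0 < S0) (hS : S0 ≤ 1 - ∑ x, r x ^ 2)
    (μ : ℝ) (hμ : 0 ≤ μ) :
    ∑ a, Real.exp (-(μ * dd r a)) ≤ p * Real.exp (-(μ * S0 * (1 - μ * S0))) := by
  set S := 1 - ∑ x, r x ^ 2 with hSdef
  have hSpos : 0 < S := hS0.trans_le hS
  have key : ∀ a, Real.exp (-(μ * dd r a))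
      ≤ 1 - (μ * (S0 / S) * dd r a) * (1 - μ * S0) := by
    intro a
    have hd := dd_nonneg r h0 h1 a
    have hd2 : dd r a ≤ 2 * S := dd_le r h0 h1 a
    have hρ : S0 / S ≤ 1 := (div_le_one hSpos).2 hS
    have hρ0 : 0 ≤ S0 / S := by positivity
    set z := μ * (S0 / S) * dd r a with hz
    have hz0 : 0 ≤ z := by positivity
    have hz1 : z ≤ μ * dd r a := by
      rw [hz, mul_assoc]
      exact mul_le_mul_of_nonneg_left (mul_le_of_le_one_left hd hρ) hμ
    have hz2 : z ≤ 2 * (μ * S0) := by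
      calc z ≤ μ * (S0 / S) * (2 * S) := mul_le_mul_of_nonneg_left hd2 (by positivity)
        _ = 2 * (μ * S0) := by field_simp
    calc Real.exp (-(μ * dd r a)) ≤ Real.exp (-z) := Real.exp_le_exp.2 (neg_le_neg hz1)
      _ ≤ 1 - z + z ^ 2 / 2 := exp_neg_le z hz0
      _ ≤ _ := by nlinarith
  calc ∑ a, Real.exp (-(μ * dd r a))
      ≤ ∑ a, (1 - (μ * (S0 / S) * dd r a) * (1 - μ * S0)) := sum_le_sum fun a _ => key a
    _ = p * (1 - μ * S0 * (1 - μ * S0)) := by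
        rw [sum_sub_distrib, ← sum_mul, ← mul_sum, sum_dd r h1, ← hSdef]
        simp only [sum_const, card_univ, ZMod.card, nsmul_eq_mul, mul_one]
        field_simp
    _ ≤ _ := by
        gcongr
        have := Real.add_one_le_exp (-(μ * S0 * (1 - μ * S0)))
        linarith

/-- Fourier inversion bound. -/
lemma fourier {p : ℕ} [Fact p.Prime] {J σ : Type*} [Fintype J] [DecidableEq J] [Fintype σ]
    [DecidableEq σ]
    (r : J → ZMod p → ℝ) (h1 : ∀ j, ∑ a, r j a = 1)
    (V : Matrix σ J (ZMod p)) (c : σ → ZMod p) :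
    |(∑ x : J → ZMod p, (∏ j, r j (x j)) * (if V.mulVec x = c then 1 else 0))
      - ((p : ℝ) ^ Fintype.card σ)⁻¹|
      ≤ ((p : ℝ) ^ Fintype.card σ)⁻¹ * ∑ t ∈ univ.filter (fun t : σ → ZMod p => t ≠ 0),
        Real.exp (-(1 / 2 * ∑ j, dd (r j) (Matrix.vecMul t V j))) := by
  classical
  have hp : (p : ℂ) ≠ 0 := by exact_mod_cast (Fact.out : p.Prime).ne_zero
  have hind : ∀ y : σ → ZMod p, (if y = 0 then (1:ℂ) else 0)
      = ((p : ℂ) ^ Fintype.card σ)⁻¹ * ∑ t : σ → ZMod p, ∏ i, (ZMod.stdAddChar (t i * y i) : ℂ) := by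
    intro y
    have := Finset.prod_univ_sum (fun _ : σ => (univ : Finset (ZMod p)))
      (fun i a => (ZMod.stdAddChar (a * y i) : ℂ))
    rw [Fintype.piFinset_univ] at this
    rw [← this]
    simp only [AddChar.sum_mulShift (R' := ℂ) _ (ZMod.isPrimitive_stdAddChar p)]
    split_ifs with h
    · subst h
      simp [hp]
    · obtain ⟨i, hi⟩ := Function.ne_iff.1 h
      rw [Finset.prod_eq_zero (mem_univ i)]
      · simp
      · rw [if_neg (by simpa using hi)]; simp
  have hchar : ∀ (t : σ → ZMod p) (x : J → ZMod p),
      ∏ i, (ZMod.stdAddChar (t i * (V.mulVec x - c) i) : ℂ)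
        = (ZMod.stdAddChar (-(t ⬝ᵥ c)) : ℂ) * ∏ j, (ZMod.stdAddChar (x j * Matrix.vecMul t V j) : ℂ) := by
    intro t x
    rw [← map_sum_prod, ← map_sum_prod, ← AddChar.map_add_eq_mul]
    congr 1
    change t ⬝ᵥ (V.mulVec x - c) = _ + x ⬝ᵥ (Matrix.vecMul t V)
    rw [dotProduct_sub, Matrix.dotProduct_mulVec, dotProduct_comm x]
    ring
  have hmain : ((∑ x : J → ZMod p, (∏ j, r j (x j)) * (if V.mulVec x = c then 1 else 0) : ℝ) : ℂ)
      = ((p : ℂ) ^ Fintype.card σ)⁻¹ * ∑ t : σ → ZMod p, (ZMod.stdAddChar (-(t ⬝ᵥ c)) : ℂ) *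
          ∏ j, phi (r j) (Matrix.vecMul t V j) := by
    push_cast
    have e1 : ∀ x : J → ZMod p, (((if V.mulVec x = c then 1 else 0) : ℝ) : ℂ)
      = ((p : ℂ) ^ Fintype.card σ)⁻¹ * ∑ t : σ → ZMod p, (ZMod.stdAddChar (-(t ⬝ᵥ c)) : ℂ) * ∏ j, (ZMod.stdAddChar (x j * Matrix.vecMul t V j) : ℂ) := by
      intro x
      rw [← sum_congr rfl (fun t _ => hchar t x), ← hind]
      simp only [sub_eq_zero]
      split_ifs <;> simp
    simp only [e1]
    rw [mul_sum]
    simp only [mul_sum]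
    rw [sum_comm]
    refine sum_congr rfl fun t _ => ?_
    simp only [phi]
    rw [Finset.prod_univ_sum, Fintype.piFinset_univ, mul_sum, mul_sum]
    refine sum_congr rfl fun x _ => ?_
    rw [prod_mul_distrib]
    ring
  have hphi0 : ∀ j, phi (r j) 0 = 1 := by
    intro j
    simp only [phi, mul_zero, AddChar.map_zero_eq_one, mul_one]
    exact_mod_cast h1 j
  have hsplit : ((∑ x : J → ZMod p, (∏ j, r j (x j)) * (if V.mulVec x = c then 1 else 0)
      - ((p : ℝ) ^ Fintype.card σ)⁻¹ : ℝ) : ℂ)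
      = ((p : ℂ) ^ Fintype.card σ)⁻¹ * ∑ t ∈ univ.filter (fun t : σ → ZMod p => t ≠ 0),
        (ZMod.stdAddChar (-(t ⬝ᵥ c)) : ℂ) * ∏ j, phi (r j) (Matrix.vecMul t V j) := by
    rw [Complex.ofReal_sub, hmain, ← add_sum_erase univ _ (mem_univ (0 : σ → ZMod p)), mul_add]
    simp only [zero_dotProduct, neg_zero, AddChar.map_zero_eq_one, Matrix.zero_vecMul,
      Pi.zero_apply, hphi0, prod_const_one, mul_one]
    push_cast
    rw [add_sub_cancel_left, filter_ne']
  rw [← Real.norm_eq_abs, ← Complex.norm_real, hsplit, norm_mul]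
  have : ‖((p : ℂ) ^ Fintype.card σ)⁻¹‖ = ((p : ℝ) ^ Fintype.card σ)⁻¹ := by simp
  rw [this]
  gcongr
  refine (norm_sum_le _ _).trans (sum_le_sum fun t _ => ?_)
  rw [norm_mul, AddChar.norm_apply, one_mul, norm_prod, mul_sum, ← sum_neg_distrib, Real.exp_sum]
  refine prod_le_prod (fun _ _ => norm_nonneg _) fun j _ => ?_
  set y := ‖phi (r j) (Matrix.vecMul t V j)‖ with hy
  have hd : dd (r j) (Matrix.vecMul t V j) = 1 - y ^ 2 := rfl
  rw [hd]
  have h2 : y ^ 2 ≤ Real.exp (-(1 / 2 * (1 - y ^ 2))) ^ 2 := by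
    rw [← Real.exp_nat_mul]
    have := Real.add_one_le_exp (-(1 - y ^ 2))
    push_cast
    ring_nf at this ⊢
    linarith
  exact le_of_sq_le_sq h2 (Real.exp_pos _).le

end RankUniv

namespace RankUniv
open Finset

/-- Probability that `w ⬝ x = c` for independent coordinates of `x`. -/
noncomputable def pz {p : ℕ} [Fact p.Prime] {J : Type*} [Fintype J] [DecidableEq J]
    (r : J → ZMod p → ℝ) (w : J → ZMod p) (c : ZMod p) : ℝ :=
  ∑ x : J → ZMod p, (∏ j, r j (x j)) * (if w ⬝ᵥ x = c then 1 else 0)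

/-- Hamming weight. -/
def wt {p : ℕ} {J : Type*} [Fintype J] (w : J → ZMod p) : ℕ :=
  (univ.filter (fun j => w j ≠ 0)).card

lemma pz_nonneg {p : ℕ} [Fact p.Prime] {J : Type*} [Fintype J] [DecidableEq J]
    (r : J → ZMod p → ℝ) (h0 : ∀ j a, 0 ≤ r j a) (w : J → ZMod p) (c : ZMod p) :
    0 ≤ pz r w c :=
  sum_nonneg fun x _ => mul_nonneg (prod_nonneg fun j _ => h0 _ _) (by split_ifs <;> norm_num)

lemma total {p : ℕ} [Fact p.Prime] {J : Type*} [Fintype J] [DecidableEq J]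
    (r : J → ZMod p → ℝ) (h1 : ∀ j, ∑ a, r j a = 1) :
    ∑ x : J → ZMod p, ∏ j, r j (x j) = 1 := by
  rw [← Fintype.prod_sum]
  simp [h1]

lemma pz_sum {p : ℕ} [Fact p.Prime] {J : Type*} [Fintype J] [DecidableEq J]
    (r : J → ZMod p → ℝ) (h1 : ∀ j, ∑ a, r j a = 1) (w : J → ZMod p) :
    ∑ c, pz r w c = 1 := by
  simp only [pz]
  rw [sum_comm]
  simp only [← mul_sum]
  simp [total r h1]

lemma conv_le {p : ℕ} [Fact p.Prime] (r g : ZMod p → ℝ) (h0 : ∀ a, 0 ≤ r a)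
    (h1 : ∑ a, r a = 1) (α : ℝ) (hα : α ≤ 1 / 2) (hb : ∀ a, r a ≤ 1 - α)
    (g0 : ∀ a, 0 ≤ g a) (g1 : ∑ a, g a = 1) (B : ℝ) (hB : 1 / 2 ≤ B) (gB : ∀ a, g a ≤ B) :
    ∑ a, r a * g a ≤ (1 - 2 * α) * B + α := by
  obtain ⟨x0, -, hmax⟩ := exists_max_image (univ : Finset (ZMod p)) g ⟨0, mem_univ _⟩
  have hM := gB x0
  by_cases h : g x0 < 1 / 2
  · have : ∑ a, r a * g a ≤ ∑ a, r a * g x0 :=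
      sum_le_sum fun a ha => mul_le_mul_of_nonneg_left (hmax a ha) (h0 a)
    rw [← sum_mul, h1, one_mul] at this
    nlinarith
  · have hoth : ∀ a ∈ univ.erase x0, g a ≤ 1 - g x0 := by
      intro a ha
      rw [← g1, ← add_sum_erase _ _ (mem_univ x0), add_sub_cancel_left]
      exact single_le_sum (f := g) (fun i _ => g0 i) ha
    have hs : ∑ x ∈ univ.erase x0, r x = 1 - r x0 := by
      rw [← h1, ← add_sum_erase _ _ (mem_univ x0)]; ring
    rw [← add_sum_erase _ _ (mem_univ x0)]
    have : ∑ a ∈ univ.erase x0, r a * g a ≤ ∑ a ∈ univ.erase x0, r a * (1 - g x0) :=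
      sum_le_sum fun a ha => mul_le_mul_of_nonneg_left (hoth a ha) (h0 a)
    rw [← sum_mul, hs] at this
    have := hb x0
    nlinarith

lemma pz_succ {p : ℕ} [Fact p.Prime] {m : ℕ} (r : Fin (m + 1) → ZMod p → ℝ)
    (w : Fin (m + 1) → ZMod p) (c : ZMod p) :
    pz r w c = ∑ a, r 0 a * pz (fun j : Fin m => r j.succ) (fun j => w j.succ) (c - w 0 * a) := by
  simp only [pz]
  rw [← (Fin.consEquiv (fun _ => ZMod p)).sum_comp, Fintype.sum_prod_type]
  refine sum_congr rfl fun a _ => ?_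
  rw [mul_sum]
  refine sum_congr rfl fun x _ => ?_
  have : (w ⬝ᵥ (Fin.consEquiv (fun _ => ZMod p)) (a, x) = c)
      ↔ ((fun j : Fin m => w j.succ) ⬝ᵥ x = c - w 0 * a) := by
    simp only [dotProduct, Fin.sum_univ_succ, Fin.consEquiv_apply, Fin.cons_zero, Fin.cons_succ]
    rw [eq_sub_iff_add_eq, add_comm]
  simp only [this, Fin.prod_univ_succ, Fin.consEquiv_apply, Fin.cons_zero, Fin.cons_succ]
  ring

lemma wt_succ {p : ℕ} {m : ℕ} (w : Fin (m + 1) → ZMod p) :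
    wt w = (if w 0 ≠ 0 then 1 else 0) + wt (fun j : Fin m => w j.succ) := by
  simp only [wt, card_filter, Fin.sum_univ_succ]

lemma pz_le {p : ℕ} [Fact p.Prime] (α : ℝ) (hα0 : 0 ≤ α) (hα : α ≤ 1 / 2) : ∀ {m : ℕ}
    (r : Fin m → ZMod p → ℝ) (_ : ∀ j a, 0 ≤ r j a) (_ : ∀ j, ∑ a, r j a = 1)
    (_ : ∀ j a, r j a ≤ 1 - α) (w : Fin m → ZMod p) (c : ZMod p),
    pz r w c ≤ 1 / 2 + 1 / 2 * (1 - 2 * α) ^ wt w := by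
  intro m
  induction m with
  | zero =>
    intro r h0 h1 hb w c
    simp only [pz, wt]
    simp
    split_ifs <;> norm_num
  | succ m ih =>
    intro r h0 h1 hb w c
    have ih' := ih (fun j : Fin m => r j.succ) (fun j => h0 _) (fun j => h1 _) (fun j => hb _)
      (fun j => w j.succ)
    rw [pz_succ, wt_succ]
    by_cases hw : w 0 = 0
    · simp only [hw, zero_mul, sub_zero, ← sum_mul, h1]
      simpa using ih' c
    · simp only [ne_eq, hw, not_false_eq_true, if_true]
      set k := wt (fun j : Fin m => w j.succ) with hk
      have hpos : 0 ≤ (1 - 2 * α) ^ k := pow_nonneg (by linarith) _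
      have hbij : ∑ a, pz (fun j : Fin m => r j.succ) (fun j => w j.succ) (c - w 0 * a) = 1 := by
        rw [← pz_sum (fun j : Fin m => r j.succ) (fun j => h1 _) (fun j => w j.succ)]
        exact ((Equiv.mulLeft₀ (w 0) hw).trans (Equiv.subLeft c)).sum_comp
          (pz (fun j : Fin m => r j.succ) (fun j => w j.succ))
      have := conv_le (r 0) _ (h0 0) (h1 0) α hα (hb 0)
        (fun a => pz_nonneg _ (fun j => h0 _) _ (c - w 0 * a)) hbij
        (1 / 2 + 1 / 2 * (1 - 2 * α) ^ k) (by linarith) (fun a => ih' _)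
      refine this.trans (le_of_eq ?_)
      rw [pow_add]; ring

/-- Generating function of weights. -/
lemma sum_pow_wt {p : ℕ} [Fact p.Prime] {J : Type*} [Fintype J] [DecidableEq J] (z : ℝ) :
    ∑ w : J → ZMod p, z ^ wt w = (1 + (p - 1) * z) ^ Fintype.card J := by
  have h : ∀ w : J → ZMod p, z ^ wt w = ∏ j, (if w j ≠ 0 then z else 1) := by
    intro w
    rw [wt, prod_ite]; simp
  simp only [h]
  rw [← Fintype.prod_sum (fun (_ : J) (a : ZMod p) => if a ≠ 0 then z else 1)]
  rw [prod_const, card_univ, ← add_sum_erase _ _ (mem_univ (0 : ZMod p))]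
  congr 1
  rw [sum_congr rfl (g := fun _ => z)]
  · have : 1 ≤ p := (Fact.out : p.Prime).one_le
    simp [ZMod.card, Nat.cast_sub this]
  · intro a ha
    simp [(mem_erase.1 ha).1]

/-- The low weight sum. -/
lemma low_sum {p : ℕ} [Fact p.Prime] {m : ℕ} {I : Type*} [Fintype I]
    (α : ℝ) (hα0 : 0 ≤ α) (hα : α ≤ 1 / 2)
    (Q : I → Fin m → ZMod p → ℝ) (h0 : ∀ i j a, 0 ≤ Q i j a) (h1 : ∀ i j, ∑ a, Q i j a = 1)
    (hb : ∀ i j a, Q i j a ≤ 1 - α) (x0 t d : ℝ) (hx0 : 0 ≤ x0)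
    (ht0 : 0 < t) (ht1 : t ≤ 1) :
    ∑ w ∈ univ.filter (fun w : Fin m → ZMod p => w ≠ 0 ∧ (wt w : ℝ) ≤ d),
      ∏ i, pz (Q i) w 0
    ≤ ((1 + (p - 1) * Real.exp (-(α * (1 - x0 / 2) * Fintype.card I))) ^ m - 1)
      + (1 / 2 + 1 / 2 * Real.exp (-x0)) ^ Fintype.card I * (t ^ (-d) * (1 + (p - 1) * t) ^ m) := by
  set z := Real.exp (-(α * (1 - x0 / 2) * Fintype.card I)) with hz
  set b := 1 / 2 + 1 / 2 * Real.exp (-x0) with hbdef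
  have key : ∀ w ∈ univ.filter (fun w : Fin m → ZMod p => w ≠ 0 ∧ (wt w : ℝ) ≤ d),
      ∏ i, pz (Q i) w 0 ≤ z ^ wt w + b ^ Fintype.card I * (t ^ (-d) * t ^ wt w) := by
    intro w hw
    obtain ⟨hw0, hwd⟩ := (mem_filter.1 hw).2
    have hb0 : 0 ≤ b := by positivity
    have hz0 : 0 ≤ z := (Real.exp_pos _).le
    have hexp : (1 - 2 * α) ^ wt w ≤ Real.exp (-(2 * α * wt w)) := by
      have : 1 - 2 * α ≤ Real.exp (-(2 * α)) := by
        have := Real.add_one_le_exp (-(2 * α)); linarith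
      calc (1 - 2 * α) ^ wt w ≤ Real.exp (-(2 * α)) ^ wt w :=
            pow_le_pow_left₀ (by linarith) this _
        _ = _ := by rw [← Real.exp_nat_mul]; ring_nf
    have hpz : ∀ i, pz (Q i) w 0 ≤ 1 / 2 + 1 / 2 * Real.exp (-(2 * α * wt w)) := fun i =>
      (pz_le α hα0 hα (Q i) (h0 i) (h1 i) (hb i) w 0).trans (by linarith)
    have hprod : ∀ C : ℝ, 1 / 2 + 1 / 2 * Real.exp (-(2 * α * wt w)) ≤ C →
        ∏ i, pz (Q i) w 0 ≤ C ^ Fintype.card I := by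
      intro C hC
      calc ∏ i, pz (Q i) w 0 ≤ ∏ i : I, C :=
            prod_le_prod (fun i _ => pz_nonneg _ (h0 i) _ _) (fun i _ => (hpz i).trans hC)
        _ = _ := by simp
    by_cases hx : 2 * α * wt w ≤ x0
    · have hnn : 0 ≤ 2 * α * wt w := by positivity
      have h2 := exp_neg_le _ hnn
      set x := 2 * α * (wt w : ℝ) with hxdef
      have h3 : 1 / 2 + 1 / 2 * Real.exp (-x) ≤ Real.exp (-(x / 2 * (1 - x0 / 2))) := by
        have := Real.add_one_le_exp (-(x / 2 * (1 - x0 / 2)))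
        nlinarith
      have h4 := hprod _ h3
      have h5 : Real.exp (-(x / 2 * (1 - x0 / 2))) ^ Fintype.card I = z ^ wt w := by
        rw [hz, ← Real.exp_nat_mul, ← Real.exp_nat_mul, hxdef]; ring_nf
      rw [h5] at h4
      have : 0 ≤ b ^ Fintype.card I * (t ^ (-d) * t ^ wt w) := by positivity
      linarith
    · have h3 : 1 / 2 + 1 / 2 * Real.exp (-(2 * α * wt w)) ≤ b := by
        have : Real.exp (-(2 * α * wt w)) ≤ Real.exp (-x0) := Real.exp_le_exp.2 (by linarith)
        rw [hbdef]; linarith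
      have h4 := hprod _ h3
      have h5 : 1 ≤ t ^ (-d) * t ^ wt w := by
        rw [← Real.rpow_natCast, ← Real.rpow_add ht0]
        exact Real.one_le_rpow_of_pos_of_le_one_of_nonpos ht0 ht1 (by linarith)
      have h6 : b ^ Fintype.card I ≤ b ^ Fintype.card I * (t ^ (-d) * t ^ wt w) :=
        le_mul_of_one_le_right (by positivity) h5
      have : 0 ≤ z ^ wt w := by positivity
      linarith
  refine (sum_le_sum key).trans ?_
  rw [sum_add_distrib]
  refine add_le_add ?_ ?_
  · have hs := sum_pow_wt (p := p) (J := Fin m) z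
    rw [Fintype.card_fin] at hs
    rw [← hs, ← add_sum_erase _ _ (mem_univ (0 : Fin m → ZMod p))]
    have : wt (0 : Fin m → ZMod p) = 0 := by simp [wt]
    rw [this, pow_zero, add_sub_cancel_left]
    refine sum_le_sum_of_subset_of_nonneg ?_ fun _ _ _ => by positivity
    intro w hw
    simp only [mem_filter] at hw
    simp [hw.2.1]
  · have hs := sum_pow_wt (p := p) (J := Fin m) t
    rw [Fintype.card_fin] at hs
    rw [← mul_sum, ← mul_sum, ← hs]
    gcongr
    exact subset_univ _

end RankUniv

namespace RankUniv
open Finset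

lemma pz_fourier {p : ℕ} [Fact p.Prime] {J : Type*} [Fintype J] [DecidableEq J]
    (r : J → ZMod p → ℝ) (h1 : ∀ j, ∑ a, r j a = 1) (w : J → ZMod p) :
    pz r w 0 ≤ (p : ℝ)⁻¹ * (1 + ∑ t ∈ univ.erase (0 : ZMod p),
      Real.exp (-(1 / 2 * ∑ j, dd (r j) (t * w j)))) := by
  have h := fourier r h1 (σ := Unit) (Matrix.of fun _ => w) 0
  have e : ∑ x : J → ZMod p, (∏ j, r j (x j)) *
      (if (Matrix.of fun _ : Unit => w).mulVec x = 0 then 1 else 0) = pz r w 0 := by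
    refine sum_congr rfl fun x _ => ?_
    have : ((Matrix.of fun _ : Unit => w).mulVec x = 0) ↔ w ⬝ᵥ x = 0 := by
      rw [funext_iff]
      simp [Matrix.mulVec]
    simp only [this]
  have e2 : ∑ t ∈ univ.filter (fun t : Unit → ZMod p => t ≠ 0),
        Real.exp (-(1 / 2 * ∑ j, dd (r j) (Matrix.vecMul t (Matrix.of fun _ => w) j)))
      = ∑ t ∈ univ.erase (0 : ZMod p), Real.exp (-(1 / 2 * ∑ j, dd (r j) (t * w j))) := by
    refine sum_bij' (fun t _ => t ()) (fun t _ => fun _ => t) ?_ ?_ ?_ ?_ ?_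
    · intro t ht
      simp only [mem_filter, mem_univ, true_and, mem_erase, and_true] at ht ⊢
      intro h; apply ht; funext u; exact h
    · intro t ht
      simp only [mem_filter, mem_univ, true_and, mem_erase, and_true] at ht ⊢
      intro h; exact ht (congrFun h ())
    · intro t _; rfl
    · intro t _; rfl
    · intro t _
      simp [Matrix.vecMul, dotProduct]
  rw [e, e2] at h
  simp only [Fintype.card_unit, pow_one] at h
  have := (abs_le.1 h).2
  linarith

lemma high_sum {p : ℕ} [Fact p.Prime] {I J : Type*} [Fintype I] [Fintype J] [DecidableEq J]
    (α : ℝ) (hα0 : 0 < α) (hα : α ≤ 1 / 2)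
    (Q : I → J → ZMod p → ℝ) (h0 : ∀ i j a, 0 ≤ Q i j a) (h1 : ∀ i j, ∑ a, Q i j a = 1)
    (hb : ∀ i j a, Q i j a ≤ 1 - α) (κ : ℝ) (hκ0 : 0 < κ)
    (hκ : ∀ b : ZMod p, b ≠ 0 → κ ≤ 1 - (ZMod.stdAddChar b : ℂ).re)
    (T d μ : ℝ) (hμ : 0 ≤ μ) :
    ∑ w ∈ univ.filter (fun w : J → ZMod p => d < (wt w : ℝ)), ∏ i, pz (Q i) w 0
    ≤ (p : ℝ) ^ Fintype.card J * ((p : ℝ) ^ Fintype.card I)⁻¹ *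
      ((1 + p * Real.exp (-(T / 2))) ^ Fintype.card I
      + Fintype.card I * p * Real.exp (μ * T) *
        Real.exp (-(μ * (2 * α * (1 - α)) * (1 - μ * (2 * α * (1 - α))))) ^ Fintype.card J *
        (1 + p * Real.exp (-(κ * (2 * α * (1 - α)) * d / 2))) ^ Fintype.card I) := by
  set S0 := 2 * α * (1 - α) with hS0
  have hS0pos : 0 < S0 := by rw [hS0]; apply mul_pos <;> linarith
  set n := Fintype.card I with hn
  have hp0 : (0 : ℝ) < p := by exact_mod_cast (Fact.out : p.Prime).pos
  set E : (J → ZMod p) → I → ZMod p → ℝ := fun w i t => ∑ j, dd (Q i j) (t * w j) with hE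
  have hS : ∀ i j, S0 ≤ 1 - ∑ x, Q i j x ^ 2 := fun i j =>
    S_ge _ (h0 i j) (h1 i j) α hα (hb i j)
  have hcard : ((univ.erase (0 : ZMod p)).card : ℝ) ≤ p := by
    have : (univ.erase (0 : ZMod p)).card ≤ p := by
      simp [ZMod.card]
    exact_mod_cast this
  have hprod : ∀ (w : J → ZMod p) (R : ℝ), (∀ i, ∀ t ∈ univ.erase (0 : ZMod p), R ≤ E w i t) →
      ∏ i, pz (Q i) w 0 ≤ ((p : ℝ) ^ n)⁻¹ * (1 + p * Real.exp (-(R / 2))) ^ n := by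
    intro w R hR
    calc ∏ i, pz (Q i) w 0 ≤ ∏ i : I, ((p : ℝ)⁻¹ * (1 + p * Real.exp (-(R / 2)))) := by
          refine prod_le_prod (fun i _ => pz_nonneg _ (h0 i) _ _) fun i _ => ?_
          refine (pz_fourier (Q i) (h1 i) w).trans ?_
          gcongr
          calc _ ≤ ∑ t ∈ univ.erase (0 : ZMod p), Real.exp (-(R / 2)) := by
                refine sum_le_sum fun t ht => Real.exp_le_exp.2 ?_
                have := hR i t ht
                simp only [hE] at this
                linarith
            _ = (univ.erase (0 : ZMod p)).card * Real.exp (-(R / 2)) := by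
                rw [sum_const, nsmul_eq_mul]
            _ ≤ _ := by gcongr
      _ = _ := by rw [prod_const, card_univ, mul_pow, inv_pow]
  set G1 := (1 + p * Real.exp (-(T / 2))) ^ n with hG1
  set G2 := (1 + p * Real.exp (-(κ * S0 * d / 2))) ^ n with hG2
  have hG10 : 0 ≤ G1 := by positivity
  have hG20 : 0 ≤ G2 := by positivity
  have key : ∀ w ∈ univ.filter (fun w : J → ZMod p => d < (wt w : ℝ)),
      ∏ i, pz (Q i) w 0 ≤ ((p : ℝ) ^ n)⁻¹ * (G1 +
        (∑ i, ∑ t ∈ univ.erase (0 : ZMod p), Real.exp (μ * (T - E w i t))) * G2) := by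
    intro w hw
    have hwd : d < (wt w : ℝ) := (mem_filter.1 hw).2
    have hsnn : 0 ≤ ∑ i, ∑ t ∈ univ.erase (0 : ZMod p), Real.exp (μ * (T - E w i t)) :=
      sum_nonneg fun i _ => sum_nonneg fun t _ => (Real.exp_pos _).le
    by_cases hgood : ∀ i, ∀ t ∈ univ.erase (0 : ZMod p), T ≤ E w i t
    · refine (hprod w T hgood).trans ?_
      gcongr
      have := mul_nonneg hsnn hG20
      linarith
    · push Not at hgood
      obtain ⟨i0, t0, ht0, hlt⟩ := hgood
      have hhigh : ∀ i, ∀ t ∈ univ.erase (0 : ZMod p), κ * S0 * d ≤ E w i t := by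
        intro i t ht
        have htne : t ≠ 0 := (mem_erase.1 ht).1
        calc κ * S0 * d ≤ κ * S0 * wt w := by gcongr
          _ = ∑ j ∈ univ.filter (fun j => w j ≠ 0), κ * S0 := by
              rw [sum_const, nsmul_eq_mul, wt]; ring
          _ ≤ ∑ j ∈ univ.filter (fun j => w j ≠ 0), dd (Q i j) (t * w j) := by
              refine sum_le_sum fun j hj => ?_
              have hj' : w j ≠ 0 := (mem_filter.1 hj).2
              refine le_trans ?_ (le_dd _ (h0 i j) (h1 i j) κ hκ _ (mul_ne_zero htne hj'))
              exact mul_le_mul_of_nonneg_left (hS i j) hκ0.le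
          _ ≤ E w i t := sum_le_sum_of_subset_of_nonneg (subset_univ _)
              fun j _ _ => dd_nonneg _ (h0 i j) (h1 i j) _
      refine (hprod w _ hhigh).trans ?_
      gcongr
      have h1s : 1 ≤ ∑ i, ∑ t ∈ univ.erase (0 : ZMod p), Real.exp (μ * (T - E w i t)) := by
        calc 1 ≤ Real.exp (μ * (T - E w i0 t0)) :=
              Real.one_le_exp (mul_nonneg hμ (by linarith))
          _ ≤ ∑ t ∈ univ.erase (0 : ZMod p), Real.exp (μ * (T - E w i0 t)) :=
              single_le_sum (f := fun t => Real.exp (μ * (T - E w i0 t)))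
                (fun t _ => (Real.exp_pos _).le) ht0
          _ ≤ _ := single_le_sum
                (f := fun i => ∑ t ∈ univ.erase (0 : ZMod p), Real.exp (μ * (T - E w i t)))
                (fun i _ => sum_nonneg fun t _ => (Real.exp_pos _).le) (mem_univ i0)
      have : G2 ≤ (∑ i, ∑ t ∈ univ.erase (0 : ZMod p), Real.exp (μ * (T - E w i t))) * G2 :=
        le_mul_of_one_le_left hG20 h1s
      change G2 ≤ _
      linarith
  have hsum : ∀ i, ∀ t ∈ univ.erase (0 : ZMod p), ∑ w : J → ZMod p, Real.exp (μ * (T - E w i t))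
      ≤ Real.exp (μ * T) * ((p : ℝ) * Real.exp (-(μ * S0 * (1 - μ * S0)))) ^ Fintype.card J := by
    intro i t ht
    have htne : t ≠ 0 := (mem_erase.1 ht).1
    have e : ∀ w : J → ZMod p, Real.exp (μ * (T - E w i t))
        = Real.exp (μ * T) * ∏ j, Real.exp (-(μ * dd (Q i j) (t * w j))) := by
      intro w
      rw [← Real.exp_sum, ← Real.exp_add, sum_neg_distrib, ← mul_sum]
      simp only [hE]; ring_nf
    simp only [e]
    rw [← mul_sum, ← Fintype.prod_sum (fun j a => Real.exp (-(μ * dd (Q i j) (t * a))))]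
    gcongr
    calc _ ≤ ∏ j : J, ((p : ℝ) * Real.exp (-(μ * S0 * (1 - μ * S0)))) := by
          refine prod_le_prod (fun j _ => sum_nonneg fun a _ => (Real.exp_pos _).le) fun j _ => ?_
          refine (Equiv.sum_comp (Equiv.mulLeft₀ t htne)
            (fun a => Real.exp (-(μ * dd (Q i j) a)))).le.trans ?_
          exact sum_exp_dd _ (h0 i j) (h1 i j) S0 hS0pos (hS i j) μ hμ
      _ = _ := by rw [prod_const, card_univ]
  refine (sum_le_sum key).trans ?_
  calc _ ≤ ∑ w : J → ZMod p, ((p : ℝ) ^ n)⁻¹ * (G1 +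
        (∑ i, ∑ t ∈ univ.erase (0 : ZMod p), Real.exp (μ * (T - E w i t))) * G2) := by
        refine sum_le_sum_of_subset_of_nonneg (subset_univ _) fun w _ _ => ?_
        have hsnn : 0 ≤ ∑ i, ∑ t ∈ univ.erase (0 : ZMod p), Real.exp (μ * (T - E w i t)) :=
          sum_nonneg fun i _ => sum_nonneg fun t _ => (Real.exp_pos _).le
        positivity
    _ = ((p : ℝ) ^ n)⁻¹ * ((p : ℝ) ^ Fintype.card J * G1 +
        (∑ i, ∑ t ∈ univ.erase (0 : ZMod p), ∑ w : J → ZMod p, Real.exp (μ * (T - E w i t))) * G2) := by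
        rw [← mul_sum, sum_add_distrib, ← sum_mul, sum_comm]
        congr 2
        · simp [ZMod.card]
        · congr 1
          exact sum_congr rfl fun i _ => sum_comm
    _ ≤ ((p : ℝ) ^ n)⁻¹ * ((p : ℝ) ^ Fintype.card J * G1 +
        (∑ i : I, (p : ℝ) * (Real.exp (μ * T) * ((p : ℝ) * Real.exp (-(μ * S0 * (1 - μ * S0)))) ^ Fintype.card J)) * G2) := by
        gcongr with i
        refine (sum_le_sum (hsum i)).trans ?_
        rw [sum_const, nsmul_eq_mul]
        gcongr
    _ = _ := by
        rw [sum_const, card_univ, nsmul_eq_mul, mul_pow, ← hn]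
        ring

end RankUniv

namespace RankUniv
open Finset

lemma vker_finrank {K : Type*} [Field K] {I J : Type*} [Fintype I] [Fintype J]
    (A : Matrix I J K) :
    A.rank + Module.finrank K (LinearMap.ker A.vecMulLinear) = Fintype.card I := by
  have h := LinearMap.finrank_range_add_finrank_ker A.vecMulLinear
  rw [Module.finrank_fintype_fun_eq_card] at h
  rw [← h, ← Matrix.rank_transpose, Matrix.rank, Matrix.mulVecLin_transpose]

/-- A matrix of full column rank has an annihilating matrix. -/
lemma exists_V {K : Type*} [Field K] {I : Type*} [Fintype I] {N s : ℕ}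
    (hI : Fintype.card I = N + s) (A : Matrix I (Fin N) K)
    (hA : ∀ w, A.mulVec w = 0 → w = 0) :
    ∃ V : Matrix (Fin s) I K, (∀ v : I → K, Matrix.vecMul v A = 0 ↔ ∃ t, Matrix.vecMul t V = v)
      ∧ (∀ t, Matrix.vecMul t V = 0 → t = 0) := by
  have hrank : A.rank = N := by
    have hinj : LinearMap.ker A.mulVecLin = ⊥ := by
      rw [LinearMap.ker_eq_bot']
      intro w hw
      exact hA w hw
    have := LinearMap.finrank_range_add_finrank_ker A.mulVecLin
    rw [hinj, finrank_bot, Module.finrank_fintype_fun_eq_card, Fintype.card_fin] at this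
    simpa [Matrix.rank] using this
  have hk := vker_finrank A
  have hs : Module.finrank K (LinearMap.ker A.vecMulLinear) = s := by omega
  let b := Module.finBasisOfFinrankEq K _ hs
  have hvec : ∀ t : Fin s → K, Matrix.vecMul t (Matrix.of fun i => (b i : I → K))
      = ((∑ i, t i • b i : LinearMap.ker A.vecMulLinear) : I → K) := by
    intro t
    rw [Matrix.vecMul_eq_sum]
    simp
    rfl
  refine ⟨Matrix.of fun i => (b i : I → K), ?_, ?_⟩
  · intro v
    constructor
    · intro hv
      refine ⟨fun i => b.repr ⟨v, hv⟩ i, ?_⟩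
      rw [hvec, b.sum_repr]
    · rintro ⟨t, rfl⟩
      rw [hvec]
      exact (∑ i, t i • b i : LinearMap.ker A.vecMulLinear).2
  · intro t ht
    rw [hvec] at ht
    have h0 : (∑ i, t i • b i : LinearMap.ker A.vecMulLinear) = 0 := Subtype.ext ht
    have := (Fintype.linearIndependent_iff.1 b.linearIndependent) t h0
    exact funext this

lemma rank_fromCols {K : Type*} [Field K] {I : Type*} [Fintype I] {N s : ℕ}
    (hI : Fintype.card I = N + s) (A : Matrix I (Fin N) K) (V : Matrix (Fin s) I K)
    (h1 : ∀ v : I → K, Matrix.vecMul v A = 0 ↔ ∃ t, Matrix.vecMul t V = v)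
    (h2 : ∀ t, Matrix.vecMul t V = 0 → t = 0) (B : Matrix I (Fin s) K) :
    (Matrix.fromCols A B).rank = N + (V * B).rank := by
  have e1 := vker_finrank (Matrix.fromCols A B)
  have e2 := vker_finrank (V * B)
  have hinj : Function.Injective V.vecMulLinear := by
    rw [← LinearMap.ker_eq_bot, LinearMap.ker_eq_bot']
    exact h2
  have hmap : (LinearMap.ker (V * B).vecMulLinear).map V.vecMulLinear
      = LinearMap.ker (Matrix.fromCols A B).vecMulLinear := by
    ext v
    simp only [Submodule.mem_map, LinearMap.mem_ker, Matrix.vecMulLinear_apply,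
      Matrix.vecMul_fromCols]
    have hz : ∀ (a : Fin N → K) (b : Fin s → K), Sum.elim a b = 0 ↔ a = 0 ∧ b = 0 := by
      intro a b
      constructor
      · intro h
        exact ⟨funext fun i => congrFun h (Sum.inl i), funext fun i => congrFun h (Sum.inr i)⟩
      · rintro ⟨rfl, rfl⟩
        funext i; cases i <;> rfl
    rw [hz, h1]
    constructor
    · rintro ⟨t, ht, rfl⟩
      exact ⟨⟨t, rfl⟩, by rw [Matrix.vecMul_vecMul]; exact ht⟩
    · rintro ⟨⟨t, rfl⟩, h⟩
      exact ⟨t, by rw [Matrix.vecMul_vecMul] at h; exact h, rfl⟩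
  have hf : Module.finrank K (LinearMap.ker (Matrix.fromCols A B).vecMulLinear)
      = Module.finrank K (LinearMap.ker (V * B).vecMulLinear) := by
    rw [← hmap]
    exact (Submodule.equivMapOfInjective _ hinj _).finrank_eq.symm
  simp only [Fintype.card_fin] at e2
  omega

end RankUniv

namespace RankUniv
open Finset

lemma prod_diff {J : Type*} (T : Finset J) (a b : J → ℝ) (e : ℝ)
    (a0 : ∀ j, 0 ≤ a j) (a1 : ∀ j, a j ≤ 1) (b0 : ∀ j, 0 ≤ b j) (b1 : ∀ j, b j ≤ 1)
    (h : ∀ j, |a j - b j| ≤ e) : |∏ j ∈ T, a j - ∏ j ∈ T, b j| ≤ T.card * e := by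
  classical
  induction T using Finset.induction_on with
  | empty => simp
  | insert x T hx ih =>
    rw [prod_insert hx, prod_insert hx, card_insert_of_notMem hx]
    have hP : ∏ j ∈ T, b j ≤ 1 := prod_le_one (fun j _ => b0 j) (fun j _ => b1 j)
    have hP0 : 0 ≤ ∏ j ∈ T, b j := prod_nonneg (fun j _ => b0 j)
    have e1 : a x * ∏ j ∈ T, a j - b x * ∏ j ∈ T, b j
        = a x * (∏ j ∈ T, a j - ∏ j ∈ T, b j) + (a x - b x) * ∏ j ∈ T, b j := by ring
    rw [e1]
    refine (abs_add_le _ _).trans ?_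
    rw [abs_mul, abs_mul, abs_of_nonneg (a0 x), abs_of_nonneg hP0]
    have h1 : a x * |∏ j ∈ T, a j - ∏ j ∈ T, b j| ≤ T.card * e :=
      (mul_le_of_le_one_left (abs_nonneg _) (a1 x)).trans ih
    have h2 : |a x - b x| * ∏ j ∈ T, b j ≤ e :=
      (mul_le_of_le_one_right (abs_nonneg _) hP).trans (h x)
    push_cast
    linarith

lemma ind_nonneg (P : Prop) [Decidable P] : (0 : ℝ) ≤ if P then 1 else 0 := by
  split_ifs <;> norm_num

lemma ind_le (P : Prop) [Decidable P] : (if P then (1 : ℝ) else 0) ≤ 1 := by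
  split_ifs <;> norm_num

/-- weight of a matrix -/
noncomputable def mw {p : ℕ} {I J : Type*} [Fintype I] [Fintype J]
    (Q : I → J → ZMod p → ℝ) (A : Matrix I J (ZMod p)) : ℝ := ∏ i, ∏ j, Q i j (A i j)

lemma mw_nonneg {p : ℕ} {I J : Type*} [Fintype I] [Fintype J]
    (Q : I → J → ZMod p → ℝ) (h0 : ∀ i j a, 0 ≤ Q i j a) (A : Matrix I J (ZMod p)) : 0 ≤ mw Q A :=
  prod_nonneg fun _ _ => prod_nonneg fun _ _ => h0 _ _ _

lemma prod_ind {I : Type*} [Fintype I] (P : I → Prop) [∀ i, Decidable (P i)]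
    [Decidable (∀ i, P i)] :
    (if ∀ i, P i then (1 : ℝ) else 0) = ∏ i, if P i then (1 : ℝ) else 0 := by
  split_ifs with h
  · simp [h]
  · push Not at h
    obtain ⟨i, hi⟩ := h
    exact (prod_eq_zero (mem_univ i) (if_neg hi)).symm

section
variable {p : ℕ} [Fact p.Prime] {I J : Type*} [Fintype I] [Fintype J] [DecidableEq I]
  [DecidableEq J]

lemma mw_total (Q : I → J → ZMod p → ℝ) (h1 : ∀ i j, ∑ a, Q i j a = 1) :
    ∑ A : Matrix I J (ZMod p), mw Q A = 1 := by
  have := Fintype.prod_sum (fun (i : I) (x : J → ZMod p) => ∏ j, Q i j (x j))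
  simp only [total _ (h1 _), prod_const_one] at this
  exact this.symm

lemma mw_mulVec (Q : I → J → ZMod p → ℝ) (w : J → ZMod p) :
    ∑ A : Matrix I J (ZMod p), mw Q A * (if A.mulVec w = 0 then 1 else 0)
      = ∏ i, pz (Q i) w 0 := by
  simp only [pz]
  rw [Fintype.prod_sum]
  refine sum_congr rfl fun A _ => ?_
  rw [prod_mul_distrib, mw]
  congr 1
  rw [← prod_ind]
  have : (A.mulVec w = 0) ↔ ∀ i, w ⬝ᵥ A i = 0 := by
    rw [funext_iff]
    refine forall_congr' fun i => ?_
    rw [dotProduct_comm]; rfl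
  simp only [this]

lemma mw_transpose (Q : I → J → ZMod p → ℝ) (f : Matrix I J (ZMod p) → ℝ) :
    ∑ A : Matrix I J (ZMod p), mw Q A * f A
      = ∑ A : Matrix J I (ZMod p), mw (fun j i => Q i j) A * f A.transpose := by
  refine sum_bij' (fun A _ => A.transpose) (fun A _ => A.transpose) (by simp) (by simp)
    (by simp) (by simp) ?_
  intro A _
  simp only [mw, Matrix.transpose_transpose]
  rw [prod_comm]
  rfl

lemma mw_vecMul (Q : I → J → ZMod p → ℝ) (v : I → ZMod p) :
    ∑ A : Matrix I J (ZMod p), mw Q A * (if Matrix.vecMul v A = 0 then 1 else 0)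
      = ∏ j, pz (fun i => Q i j) v 0 := by
  rw [mw_transpose, ← mw_mulVec (fun j i => Q i j)]
  simp only [Matrix.vecMul_transpose]

lemma mw_mul {σ : Type*} [Fintype σ] [DecidableEq σ] (Q : I → J → ZMod p → ℝ)
    (V : Matrix σ I (ZMod p)) (C : Matrix σ J (ZMod p)) :
    ∑ B : Matrix I J (ZMod p), mw Q B * (if V * B = C then 1 else 0)
      = ∏ j, ∑ x : I → ZMod p, (∏ i, Q i j (x i)) *
          (if V.mulVec x = fun a => C a j then 1 else 0) := by
  rw [mw_transpose, Fintype.prod_sum]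
  refine sum_congr rfl fun B _ => ?_
  rw [prod_mul_distrib, mw]
  congr 1
  rw [← prod_ind]
  have : (V * B.transpose = C) ↔ ∀ j, V.mulVec (B j) = fun a => C a j := by
    constructor
    · rintro rfl j
      funext a; rfl
    · intro h
      ext a j
      exact congrFun (h j) a
  simp only [this]

end

/-- Proportion of matrices of rank `s - k`. -/
noncomputable def uu (p : ℕ) [Fact p.Prime] (s k : ℕ) : ℝ :=
  ((univ.filter (fun C : Matrix (Fin s) (Fin s) (ZMod p) => C.rank = s - k)).card : ℝ)
    * (((p : ℝ) ^ s)⁻¹) ^ s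

lemma uu_nonneg (p : ℕ) [Fact p.Prime] (s k : ℕ) : 0 ≤ uu p s k := by
  unfold uu; positivity

lemma uu_le_one (p : ℕ) [Fact p.Prime] (s k : ℕ) : uu p s k ≤ 1 := by
  unfold uu
  have hp0 : (0 : ℝ) < p := by exact_mod_cast (Fact.out : p.Prime).pos
  rw [inv_pow, ← div_eq_mul_inv, div_le_one (by positivity)]
  have h := card_filter_le (univ : Finset (Matrix (Fin s) (Fin s) (ZMod p))) (fun C => C.rank = s - k)
  have h2 : (univ : Finset (Matrix (Fin s) (Fin s) (ZMod p))).card = (p ^ s) ^ s := by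
    rw [card_univ]
    change Fintype.card (Fin s → Fin s → ZMod p) = _
    simp [ZMod.card]
  rw [h2] at h
  exact_mod_cast h

/-- The last `s` columns behave like uniform ones. -/
lemma last_cols {p : ℕ} [Fact p.Prime] {I : Type*} [Fintype I] [DecidableEq I] {s : ℕ}
    (α : ℝ) (hα0 : 0 < α) (hα : α ≤ 1 / 2)
    (Q : I → Fin s → ZMod p → ℝ) (h0 : ∀ i j a, 0 ≤ Q i j a) (h1 : ∀ i j, ∑ a, Q i j a = 1)
    (hb : ∀ i j a, Q i j a ≤ 1 - α) (κ : ℝ) (hκ0 : 0 < κ)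
    (hκ : ∀ b : ZMod p, b ≠ 0 → κ ≤ 1 - (ZMod.stdAddChar b : ℂ).re) (d : ℝ) (k : ℕ)
    (V : Matrix (Fin s) I (ZMod p)) (hV : ∀ t, t ≠ 0 → d < (wt (Matrix.vecMul t V) : ℝ)) :
    |∑ B : Matrix I (Fin s) (ZMod p), mw Q B * (if (V * B).rank = s - k then 1 else 0) - uu p s k|
      ≤ ((p : ℝ) ^ s) ^ s * (s * Real.exp (-(κ * (2 * α * (1 - α)) * d / 2))) := by
  set e := Real.exp (-(κ * (2 * α * (1 - α)) * d / 2)) with he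
  have hp1 : (1 : ℝ) ≤ p := by exact_mod_cast (Fact.out : p.Prime).one_le
  have hp0 : (0 : ℝ) < p := by linarith
  have hsplit : ∑ B : Matrix I (Fin s) (ZMod p), mw Q B * (if (V * B).rank = s - k then 1 else 0)
      = ∑ C ∈ univ.filter (fun C : Matrix (Fin s) (Fin s) (ZMod p) => C.rank = s - k),
        ∑ B : Matrix I (Fin s) (ZMod p), mw Q B * (if V * B = C then 1 else 0) := by
    rw [sum_comm]
    refine sum_congr rfl fun B _ => ?_
    rw [← mul_sum]
    congr 1
    rw [sum_ite_eq]
    simp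
  have hC : ∀ C : Matrix (Fin s) (Fin s) (ZMod p),
      |∑ B : Matrix I (Fin s) (ZMod p), mw Q B * (if V * B = C then 1 else 0)
        - (((p : ℝ) ^ s)⁻¹) ^ s| ≤ s * e := by
    intro C
    rw [mw_mul]
    have hpr : (((p : ℝ) ^ s)⁻¹) ^ s = ∏ _j : Fin s, ((p : ℝ) ^ s)⁻¹ := by simp
    rw [hpr]
    have hle := prod_diff (univ : Finset (Fin s)) (fun j => ∑ x : I → ZMod p,
      (∏ i, Q i j (x i)) * (if V.mulVec x = fun a => C a j then 1 else 0))
      (fun _ => ((p : ℝ) ^ s)⁻¹) e ?_ ?_ ?_ ?_ ?_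
    · simpa using hle
    · intro j
      exact sum_nonneg fun x _ => mul_nonneg (prod_nonneg fun i _ => h0 _ _ _) (ind_nonneg _)
    · intro j
      refine le_of_le_of_eq ?_ (total (fun i => Q i j) (fun i => h1 i j))
      exact sum_le_sum fun x _ => mul_le_of_le_one_right (prod_nonneg fun i _ => h0 _ _ _) (ind_le _)
    · intro j; positivity
    · intro j; exact inv_le_one_of_one_le₀ (one_le_pow₀ hp1)
    · intro j
      have hf := fourier (fun i => Q i j) (fun i => h1 i j) V (fun a => C a j)
      rw [Fintype.card_fin] at hf
      refine hf.trans ?_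
      rw [inv_mul_le_iff₀ (by positivity)]
      calc _ ≤ ∑ t ∈ univ.filter (fun t : Fin s → ZMod p => t ≠ 0), e := by
            refine sum_le_sum fun t ht => Real.exp_le_exp.2 ?_
            have ht0 : t ≠ 0 := (mem_filter.1 ht).2
            have hd := hV t ht0
            set w := Matrix.vecMul t V with hw
            have hS0 : 0 < 2 * α * (1 - α) := by apply mul_pos <;> linarith
            have : κ * (2 * α * (1 - α)) * d ≤ ∑ i, dd (Q i j) (w i) := by
              calc κ * (2 * α * (1 - α)) * d ≤ κ * (2 * α * (1 - α)) * wt w := by gcongr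
                _ = ∑ i ∈ univ.filter (fun i => w i ≠ 0), κ * (2 * α * (1 - α)) := by
                    rw [sum_const, nsmul_eq_mul, wt]; ring
                _ ≤ ∑ i ∈ univ.filter (fun i => w i ≠ 0), dd (Q i j) (w i) := by
                    refine sum_le_sum fun i hi => ?_
                    have hi' : w i ≠ 0 := (mem_filter.1 hi).2
                    refine le_trans ?_ (le_dd _ (h0 i j) (h1 i j) κ hκ _ hi')
                    exact mul_le_mul_of_nonneg_left (S_ge _ (h0 i j) (h1 i j) α hα (hb i j)) hκ0.le
                _ ≤ _ := sum_le_sum_of_subset_of_nonneg (subset_univ _)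
                    fun i _ _ => dd_nonneg _ (h0 i j) (h1 i j) _
            linarith
        _ = (univ.filter (fun t : Fin s → ZMod p => t ≠ 0)).card * e := by
            rw [sum_const, nsmul_eq_mul]
        _ ≤ (p : ℝ) ^ s * e := by
            gcongr
            have h := card_filter_le (univ : Finset (Fin s → ZMod p)) (fun t => t ≠ 0)
            rw [card_univ, Fintype.card_fun, ZMod.card, Fintype.card_fin] at h
            exact_mod_cast h
  rw [hsplit, uu, ← nsmul_eq_mul, ← sum_const, ← sum_sub_distrib]
  refine (abs_sum_le_sum_abs _ _).trans ((sum_le_sum fun C _ => hC C).trans ?_)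
  rw [sum_const, nsmul_eq_mul]
  gcongr
  have h := card_filter_le (univ : Finset (Matrix (Fin s) (Fin s) (ZMod p))) (fun C => C.rank = s - k)
  have h2 : (univ : Finset (Matrix (Fin s) (Fin s) (ZMod p))).card = (p ^ s) ^ s := by
    rw [card_univ]
    change Fintype.card (Fin s → Fin s → ZMod p) = _
    simp [ZMod.card]
  rw [h2] at h
  exact_mod_cast h

end RankUniv

namespace RankUniv
open Finset

/-- Splitting the columns. -/
def splitEquiv (K I : Type*) (N s : ℕ) :
    Matrix I (Fin N) K × Matrix I (Fin s) K ≃ Matrix I (Fin (N + s)) K where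
  toFun AB := Matrix.reindex (Equiv.refl I) finSumFinEquiv (Matrix.fromCols AB.1 AB.2)
  invFun M := (fun i j => M i (Fin.castAdd s j), fun i j => M i (Fin.natAdd N j))
  left_inv AB := by
    ext <;> simp
  right_inv M := by
    ext i j
    refine Fin.addCases (fun j => ?_) (fun j => ?_) j <;> simp <;> rfl

lemma splitEquiv_rank {K I : Type*} [Field K] [Fintype I] {N s : ℕ} (A : Matrix I (Fin N) K)
    (B : Matrix I (Fin s) K) : (splitEquiv K I N s (A, B)).rank = (Matrix.fromCols A B).rank :=
  Matrix.rank_reindex (Equiv.refl I) finSumFinEquiv (Matrix.fromCols A B)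

lemma splitEquiv_prod {p N s : ℕ} {I : Type*} [Fintype I]
    (q : I → Fin (N + s) → ZMod p → ℝ) (A : Matrix I (Fin N) (ZMod p))
    (B : Matrix I (Fin s) (ZMod p)) :
    ∏ i, ∏ j, q i j (splitEquiv (ZMod p) I N s (A, B) i j)
        = mw (fun i j => q i (Fin.castAdd s j)) A * mw (fun i j => q i (Fin.natAdd N j)) B := by
  rw [mw, mw, ← prod_mul_distrib]
  refine prod_congr rfl fun i _ => ?_
  rw [Fin.prod_univ_add]
  simp [splitEquiv]

set_option maxHeartbeats 1000000 in
lemma main_bound {p : ℕ} [Fact p.Prime] {N s : ℕ} (k : ℕ) (hk : k ≤ s)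
    (α : ℝ) (hα0 : 0 < α) (hα : α ≤ 1 / 2)
    (q : Fin (N + s) → Fin (N + s) → ZMod p → ℝ)
    (h0 : ∀ i j a, 0 ≤ q i j a) (h1 : ∀ i j, ∑ a, q i j a = 1)
    (hb : ∀ i j a, q i j a ≤ 1 - α) (κ : ℝ) (hκ0 : 0 < κ)
    (hκ : ∀ b : ZMod p, b ≠ 0 → κ ≤ 1 - (ZMod.stdAddChar b : ℂ).re) (d : ℝ) (hd : 0 ≤ d) :
    |∑ M ∈ univ.filter (fun M : Matrix (Fin (N + s)) (Fin (N + s)) (ZMod p) =>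
        M.rank = N + s - k), ∏ i, ∏ j, q i j (M i j) - uu p s k|
    ≤ ((p : ℝ) ^ s) ^ s * (s * Real.exp (-(κ * (2 * α * (1 - α)) * d / 2)))
      + (∑ w ∈ univ.filter (fun w : Fin N → ZMod p => w ≠ 0 ∧ (wt w : ℝ) ≤ d),
          ∏ i, pz (fun j => q i (Fin.castAdd s j)) w 0
        + ∑ w ∈ univ.filter (fun w : Fin N → ZMod p => d < (wt w : ℝ)),
          ∏ i, pz (fun j => q i (Fin.castAdd s j)) w 0
        + ∑ v ∈ univ.filter (fun v : Fin (N + s) → ZMod p => v ≠ 0 ∧ (wt v : ℝ) ≤ d),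
          ∏ j : Fin N, pz (fun i => q i (Fin.castAdd s j)) v 0) := by
  classical
  set qA : Fin (N + s) → Fin N → ZMod p → ℝ := fun i j => q i (Fin.castAdd s j) with hqA
  set qB : Fin (N + s) → Fin s → ZMod p → ℝ := fun i j => q i (Fin.natAdd N j) with hqB
  set η := ((p : ℝ) ^ s) ^ s * (s * Real.exp (-(κ * (2 * α * (1 - α)) * d / 2))) with hη
  have hη0 : 0 ≤ η := by positivity
  set g : Matrix (Fin (N + s)) (Fin N) (ZMod p) → ℝ := fun A =>
    ∑ B : Matrix (Fin (N + s)) (Fin s) (ZMod p), mw qB B *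
      (if (Matrix.fromCols A B).rank = N + s - k then 1 else 0) with hg
  have hA0 : ∀ A, 0 ≤ mw qA A := mw_nonneg _ (fun i j => h0 _ _)
  have hB0 : ∀ B, 0 ≤ mw qB B := mw_nonneg _ (fun i j => h0 _ _)
  have hA1 : ∑ A, mw qA A = 1 := mw_total _ (fun i j => h1 _ _)
  have hB1 : ∑ B, mw qB B = 1 := mw_total _ (fun i j => h1 _ _)
  have hg0 : ∀ A, 0 ≤ g A := fun A => sum_nonneg fun B _ => mul_nonneg (hB0 B) (ind_nonneg _)
  have hg1 : ∀ A, g A ≤ 1 := fun A => by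
    refine le_of_le_of_eq ?_ hB1
    exact sum_le_sum fun B _ => mul_le_of_le_one_right (hB0 B) (ind_le _)
  have hstart : ∑ M ∈ univ.filter (fun M : Matrix (Fin (N + s)) (Fin (N + s)) (ZMod p) =>
        M.rank = N + s - k), ∏ i, ∏ j, q i j (M i j) = ∑ A, mw qA A * g A := by
    rw [sum_filter, ← (splitEquiv (ZMod p) (Fin (N + s)) N s).sum_comp, Fintype.sum_prod_type]
    refine sum_congr rfl fun A _ => ?_
    rw [hg, mul_sum]
    refine sum_congr rfl fun B _ => ?_
    rw [splitEquiv_rank, splitEquiv_prod]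
    split_ifs
    · rw [mul_one]
    · rw [mul_zero, mul_zero]
  set b1 : Matrix (Fin (N + s)) (Fin N) (ZMod p) → ℝ := fun A =>
    ∑ w ∈ univ.filter (fun w : Fin N → ZMod p => w ≠ 0 ∧ (wt w : ℝ) ≤ d),
      (if A.mulVec w = 0 then 1 else 0) with hb1
  set b2 : Matrix (Fin (N + s)) (Fin N) (ZMod p) → ℝ := fun A =>
    ∑ w ∈ univ.filter (fun w : Fin N → ZMod p => d < (wt w : ℝ)),
      (if A.mulVec w = 0 then 1 else 0) with hb2
  set b3 : Matrix (Fin (N + s)) (Fin N) (ZMod p) → ℝ := fun A =>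
    ∑ v ∈ univ.filter (fun v : Fin (N + s) → ZMod p => v ≠ 0 ∧ (wt v : ℝ) ≤ d),
      (if Matrix.vecMul v A = 0 then 1 else 0) with hb3
  have b10 : ∀ A, 0 ≤ b1 A := fun A => sum_nonneg fun _ _ => ind_nonneg _
  have b20 : ∀ A, 0 ≤ b2 A := fun A => sum_nonneg fun _ _ => ind_nonneg _
  have b30 : ∀ A, 0 ≤ b3 A := fun A => sum_nonneg fun _ _ => ind_nonneg _
  have key : ∀ A, |g A - uu p s k| ≤ η + (b1 A + b2 A + b3 A) := by
    intro A
    by_cases hgood : (∀ w, A.mulVec w = 0 → w = 0) ∧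
        (∀ v, Matrix.vecMul v A = 0 → v ≠ 0 → d < (wt v : ℝ))
    · obtain ⟨hg1, hg2⟩ := hgood
      obtain ⟨V, hV1, hV2⟩ := exists_V (Fintype.card_fin (N + s)) A hg1
      have hgA : g A = ∑ B : Matrix (Fin (N + s)) (Fin s) (ZMod p),
          mw qB B * (if (V * B).rank = s - k then 1 else 0) := by
        rw [hg]
        refine sum_congr rfl fun B _ => ?_
        rw [rank_fromCols (Fintype.card_fin (N + s)) A V hV1 hV2 B]
        have : (N + (V * B).rank = N + s - k) ↔ ((V * B).rank = s - k) := by omega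
        simp only [this]
      rw [hgA]
      have := last_cols α hα0 hα qB (fun i j => h0 _ _) (fun i j => h1 _ _) (fun i j => hb _ _)
        κ hκ0 hκ d k V (fun t ht => hg2 _ ((hV1 _).2 ⟨t, rfl⟩) (fun h => ht (hV2 t h)))
      have h1 := b10 A
      have h2 := b20 A
      have h3 := b30 A
      linarith
    · have hle1 : |g A - uu p s k| ≤ 1 := by
        rw [abs_le]
        have := hg0 A
        have := hg1 A
        have := uu_nonneg p s k
        have := uu_le_one p s k
        constructor <;> linarith
      have hbad : 1 ≤ b1 A + b2 A + b3 A := by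
        have h1 := b10 A
        have h2 := b20 A
        have h3 := b30 A
        rw [not_and_or] at hgood
        rcases hgood with h | h
        · push Not at h
          obtain ⟨w, hw, hw0⟩ := h
          by_cases hwd : (wt w : ℝ) ≤ d
          · have : (if A.mulVec w = 0 then (1:ℝ) else 0) ≤ b1 A :=
              single_le_sum (f := fun w : Fin N → ZMod p => if A.mulVec w = 0 then (1:ℝ) else 0)
                (fun _ _ => ind_nonneg _) (by simp [hw0, hwd])
            rw [if_pos hw] at this
            linarith
          · have : (if A.mulVec w = 0 then (1:ℝ) else 0) ≤ b2 A :=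
              single_le_sum (f := fun w : Fin N → ZMod p => if A.mulVec w = 0 then (1:ℝ) else 0)
                (fun _ _ => ind_nonneg _) (by simpa using hwd)
            rw [if_pos hw] at this
            linarith
        · push Not at h
          obtain ⟨v, hv, hv0, hvd⟩ := h
          have : (if Matrix.vecMul v A = 0 then (1:ℝ) else 0) ≤ b3 A :=
            single_le_sum (f := fun v : Fin (N + s) → ZMod p =>
              if Matrix.vecMul v A = 0 then (1:ℝ) else 0)
              (fun _ _ => ind_nonneg _) (by simp [hv0, hvd])
          rw [if_pos hv] at this
          linarith
      linarith
  have e1 : ∑ A, mw qA A * b1 A = ∑ w ∈ univ.filter (fun w : Fin N → ZMod p => w ≠ 0 ∧ (wt w : ℝ) ≤ d),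
          ∏ i, pz (qA i) w 0 := by
    simp only [hb1, mul_sum]
    rw [sum_comm]
    exact sum_congr rfl fun w _ => mw_mulVec qA w
  have e2 : ∑ A, mw qA A * b2 A = ∑ w ∈ univ.filter (fun w : Fin N → ZMod p => d < (wt w : ℝ)),
          ∏ i, pz (qA i) w 0 := by
    simp only [hb2, mul_sum]
    rw [sum_comm]
    exact sum_congr rfl fun w _ => mw_mulVec qA w
  have e3 : ∑ A, mw qA A * b3 A = ∑ v ∈ univ.filter (fun v : Fin (N + s) → ZMod p => v ≠ 0 ∧ (wt v : ℝ) ≤ d),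
          ∏ j : Fin N, pz (fun i => qA i j) v 0 := by
    simp only [hb3, mul_sum]
    rw [sum_comm]
    exact sum_congr rfl fun w _ => mw_vecMul qA w
  rw [hstart]
  have e4 : ∑ A, mw qA A * g A - uu p s k = ∑ A, mw qA A * (g A - uu p s k) := by
    simp only [mul_sub, sum_sub_distrib, ← sum_mul, hA1, one_mul]
  rw [e4]
  calc _ ≤ ∑ A, |mw qA A * (g A - uu p s k)| := abs_sum_le_sum_abs _ _
    _ ≤ ∑ A, mw qA A * (η + (b1 A + b2 A + b3 A)) := by
        refine sum_le_sum fun A _ => ?_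
        rw [abs_mul, abs_of_nonneg (hA0 A)]
        exact mul_le_mul_of_nonneg_left (key A) (hA0 A)
    _ = η + (∑ A, mw qA A * b1 A + ∑ A, mw qA A * b2 A + ∑ A, mw qA A * b3 A) := by
        simp only [mul_add, sum_add_distrib, ← sum_mul, hA1, one_mul]
    _ = _ := by rw [e1, e2, e3]

end RankUniv

namespace RankUniv
open Finset

lemma sum_rows (p : ℕ) [Fact p.Prime] (m n : ℕ) (g : ℕ → ℝ) :
    ∑ f : Fin (n + 1) → Fin m → ZMod p,
      g (Module.finrank (ZMod p) (Submodule.span (ZMod p) (Set.range f)))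
    = ∑ f : Fin n → Fin m → ZMod p,
      ((p : ℝ) ^ (Module.finrank (ZMod p) (Submodule.span (ZMod p) (Set.range f)))
          * g (Module.finrank (ZMod p) (Submodule.span (ZMod p) (Set.range f)))
        + ((p : ℝ) ^ m - (p : ℝ) ^ (Module.finrank (ZMod p) (Submodule.span (ZMod p) (Set.range f))))
          * g (Module.finrank (ZMod p) (Submodule.span (ZMod p) (Set.range f)) + 1)) := by
  classical
  rw [← (Fin.consEquiv (fun _ : Fin (n + 1) => Fin m → ZMod p)).sum_comp, Fintype.sum_prod_type,
    Finset.sum_comm]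
  refine Finset.sum_congr rfl fun f _ => ?_
  set W := Submodule.span (ZMod p) (Set.range f) with hW
  have key : ∀ v : Fin m → ZMod p,
      g (Module.finrank (ZMod p) (Submodule.span (ZMod p)
        (Set.range ((Fin.consEquiv (fun _ : Fin (n + 1) => Fin m → ZMod p)) (v, f)))))
      = if v ∈ W then g (Module.finrank (ZMod p) W) else g (Module.finrank (ZMod p) W + 1) := by
    intro v
    have h1 : Set.range ((Fin.consEquiv (fun _ : Fin (n + 1) => Fin m → ZMod p)) (v, f))
        = insert v (Set.range f) := by
      simp [Fin.consEquiv, Fin.range_cons]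
    rw [h1, Submodule.span_insert]
    split_ifs with hv
    · rw [← hW, sup_eq_right.mpr (by rwa [Submodule.span_singleton_le_iff_mem])]
    · congr 1
      rw [sup_comm]
      exact Submodule.finrank_sup_span_singleton hv
  rw [Finset.sum_congr rfl (fun v _ => key v), Finset.sum_ite, Finset.sum_const, Finset.sum_const]
  have hc : (univ.filter (fun v : Fin m → ZMod p => v ∈ W)).card
      = p ^ (Module.finrank (ZMod p) W) := by
    have := Module.card_eq_pow_finrank (K := ZMod p) (V := W)
    rw [ZMod.card] at this
    rw [← this, Fintype.card_subtype]
  have hc2 : (univ.filter (fun v : Fin m → ZMod p => v ∈ W)).card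
      + (univ.filter (fun v : Fin m → ZMod p => ¬ v ∈ W)).card = p ^ m := by
    rw [Finset.card_filter_add_card_filter_not]
    simp
  have hc3 : ((univ.filter (fun v : Fin m → ZMod p => ¬ v ∈ W)).card : ℝ)
      = (p : ℝ) ^ m - (p : ℝ) ^ (Module.finrank (ZMod p) W) := by
    rw [hc] at hc2
    have : ((p : ℝ) ^ (Module.finrank (ZMod p) W)
      + ((univ.filter (fun v : Fin m → ZMod p => ¬ v ∈ W)).card : ℝ)) = (p : ℝ) ^ m := by
      exact_mod_cast hc2
    linarith
  rw [nsmul_eq_mul, nsmul_eq_mul, hc3, hc]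
  push_cast
  ring

noncomputable def Rc (p : ℕ) [Fact p.Prime] (m n r : ℕ) : ℝ :=
  ∑ f : Fin n → Fin m → ZMod p,
    if Module.finrank (ZMod p) (Submodule.span (ZMod p) (Set.range f)) = r then 1 else 0

lemma Rc_succ (p : ℕ) [Fact p.Prime] (m n r : ℕ) :
    Rc p m (n + 1) (r + 1) = Rc p m n (r + 1) * (p : ℝ) ^ (r + 1)
      + Rc p m n r * ((p : ℝ) ^ m - (p : ℝ) ^ r) := by
  unfold Rc
  rw [sum_rows p m n (fun j => if j = r + 1 then (1 : ℝ) else 0), Finset.sum_mul, Finset.sum_mul,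
    ← Finset.sum_add_distrib]
  refine Finset.sum_congr rfl fun f _ => ?_
  generalize Module.finrank (ZMod p) (Submodule.span (ZMod p) (Set.range f)) = j
  by_cases h1 : j = r
  · subst h1; simp
  · by_cases h2 : j = r + 1
    · subst h2; simp
    · simp [h1, h2]

lemma Rc_zero (p : ℕ) [Fact p.Prime] (m n : ℕ) : Rc p m n 0 = 1 := by
  induction n with
  | zero => simp [Rc]
  | succ n ih =>
    rw [← ih]
    unfold Rc
    rw [sum_rows p m n (fun j => if j = 0 then (1 : ℝ) else 0)]
    refine Finset.sum_congr rfl fun f _ => ?_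
    generalize Module.finrank (ZMod p) (Submodule.span (ZMod p) (Set.range f)) = j
    by_cases h1 : j = 0
    · subst h1; simp
    · simp [h1]

noncomputable def AA (Q : ℝ) (r n : ℕ) : ℝ := ∏ i ∈ range r, (Q ^ n - Q ^ i)

lemma AA_succ (Q : ℝ) (r n : ℕ) : AA Q (r + 1) n = AA Q r n * (Q ^ n - Q ^ r) := by
  unfold AA; rw [Finset.prod_range_succ]

lemma AA_succ_succ (Q : ℝ) (r n : ℕ) :
    AA Q (r + 1) (n + 1) = (Q ^ (n + 1) - 1) * Q ^ r * AA Q r n := by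
  unfold AA
  rw [Finset.prod_range_succ']
  have : ∀ i ∈ range r, Q ^ (n + 1) - Q ^ (i + 1) = Q * (Q ^ n - Q ^ i) := by
    intro i _; ring
  rw [Finset.prod_congr rfl this, Finset.prod_mul_distrib]
  simp
  ring

lemma Rc_closed (p : ℕ) [Fact p.Prime] (m n : ℕ) :
    ∀ r, Rc p m n r * AA p r r = AA p r m * AA p r n := by
  induction n with
  | zero =>
    intro r
    cases r with
    | zero => simp [Rc_zero, AA]
    | succ r =>
      have h : AA (p : ℝ) (r + 1) 0 = 0 := by
        unfold AA
        exact Finset.prod_eq_zero (i := 0) (by simp) (by simp)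
      have hz : ∀ f : Fin 0 → Fin m → ZMod p,
          Module.finrank (ZMod p) (Submodule.span (ZMod p) (Set.range f)) = 0 := by
        intro f
        rw [Set.range_eq_empty f, Submodule.span_empty, finrank_bot]
      rw [h]
      simp [Rc, hz]
  | succ n ih =>
    intro r
    cases r with
    | zero => simp [Rc_zero, AA]
    | succ r =>
      have h1 := ih (r + 1)
      have h2 := ih r
      rw [Rc_succ]
      calc _ = (Rc p m n (r + 1) * AA p (r + 1) (r + 1)) * (p : ℝ) ^ (r + 1)
            + Rc p m n r * ((p : ℝ) ^ m - (p : ℝ) ^ r) * AA p (r + 1) (r + 1) := by ring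
        _ = (AA p (r + 1) m * AA p (r + 1) n) * (p : ℝ) ^ (r + 1)
            + (Rc p m n r * AA p r r) * ((p : ℝ) ^ m - (p : ℝ) ^ r)
              * (((p : ℝ) ^ (r + 1) - 1) * p ^ r) := by
            rw [h1, AA_succ_succ]; ring
        _ = _ := by
            rw [h2, AA_succ_succ (p : ℝ) r n, AA_succ (p : ℝ) r n, AA_succ (p : ℝ) r m]; ring

noncomputable def PP (p : ℕ) (j : ℕ) : ℝ := ∏ i ∈ range j, (1 - (p : ℝ)⁻¹ ^ (i + 1))

lemma PP_pos (p : ℕ) [hp : Fact p.Prime] (j : ℕ) : 0 < PP p j := by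
  unfold PP
  refine Finset.prod_pos fun i _ => ?_
  have h2 : (1 : ℝ) < p := by exact_mod_cast hp.out.one_lt
  have := pow_lt_one₀ (a := (p : ℝ)⁻¹) (by positivity) (inv_lt_one_of_one_lt₀ h2) (Nat.add_one_ne_zero i)
  linarith

lemma AA_PP (p : ℕ) [hp : Fact p.Prime] (r k : ℕ) :
    AA p r (r + k) * PP p k = (p : ℝ) ^ ((r + k) * r) * PP p (r + k) := by
  have hp0 : (p : ℝ) ≠ 0 := by exact_mod_cast hp.out.ne_zero
  induction r with
  | zero => simp [AA]
  | succ r ih =>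
    have e : r + 1 + k = (r + k) + 1 := by ring
    have e2 : PP p (r + k + 1) = PP p (r + k) * (1 - (p : ℝ)⁻¹ ^ (r + k + 1)) := by
      unfold PP; rw [Finset.prod_range_succ]
    have e3 : (p : ℝ) ^ (r + k + 1) * (1 - (p : ℝ)⁻¹ ^ (r + k + 1)) = (p : ℝ) ^ (r + k + 1) - 1 := by
      rw [mul_sub, ← mul_pow, mul_inv_cancel₀ hp0]; simp
    have e4 : (r + k + 1) * (r + 1) = (r + k) * r + r + (r + k + 1) := by ring
    rw [e, AA_succ_succ, e2, e4, pow_add, pow_add]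
    calc _ = ((p : ℝ) ^ (r + k + 1) - 1) * p ^ r * (AA p r (r + k) * PP p k) := by ring
      _ = _ := by rw [ih, ← e3]; ring

lemma uu_eq (p : ℕ) [hp : Fact p.Prime] (r k : ℕ) :
    uu p (r + k) k = ((p : ℝ) ^ (k ^ 2))⁻¹ * (PP p (r + k)) ^ 2 / (PP p k ^ 2 * PP p r) := by
  have hp0 : (p : ℝ) ≠ 0 := by exact_mod_cast hp.out.ne_zero
  have h1 := AA_PP p r k
  have h2 := AA_PP p r 0
  have h3 := Rc_closed p (r + k) (r + k) r
  have hR : ((univ.filter (fun C : Matrix (Fin (r + k)) (Fin (r + k)) (ZMod p) =>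
      C.rank = r + k - k)).card : ℝ) = Rc p (r + k) (r + k) r := by
    unfold Rc
    rw [Finset.card_filter]
    push_cast
    refine Finset.sum_congr rfl fun f _ => ?_
    rw [Matrix.rank_eq_finrank_span_row]
    simp only [Nat.add_sub_cancel]
    rfl
  unfold uu
  rw [hR]
  have hk := (PP_pos p k).ne'
  have hr := (PP_pos p r).ne'
  have h00 : PP p 0 = 1 := by simp [PP]
  rw [h00] at h2
  simp only [add_zero, mul_one] at h2
  rw [h2] at h3
  have h4 : AA p r (r + k) = (p : ℝ) ^ ((r + k) * r) * PP p (r + k) / PP p k := by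
    field_simp; linarith
  rw [h4] at h3
  have h5 : Rc p (r + k) (r + k) r = ((p : ℝ) ^ ((r + k) * r) * PP p (r + k) / PP p k) ^ 2
      / ((p : ℝ) ^ (r * r) * PP p r) := by
    rw [eq_div_iff (by positivity)]
    linarith
  rw [h5]
  have e1 : ((p : ℝ) ^ ((r + k) * r)) ^ 2 * (p : ℝ) ^ (k ^ 2)
      = (p : ℝ) ^ (r * r) * ((p : ℝ) ^ (r + k)) ^ (r + k) := by
    rw [← pow_mul, ← pow_mul, ← pow_add, ← pow_add]; congr 1; ring
  rw [inv_pow, div_pow, mul_pow]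
  have f1 : ((p : ℝ) ^ ((r + k) * r)) ^ 2 
      = (p : ℝ) ^ (r * r) * ((p : ℝ) ^ (r + k)) ^ (r + k) * ((p : ℝ) ^ (k ^ 2))⁻¹ := by
    rw [← e1]
    rw [mul_assoc, mul_inv_cancel₀ (pow_ne_zero _ hp0), mul_one]
  rw [f1]
  have g1 : (p : ℝ) ^ (r * r) ≠ 0 := pow_ne_zero _ hp0
  have g2 : ((p : ℝ) ^ (r + k)) ^ (r + k) ≠ 0 := pow_ne_zero _ (pow_ne_zero _ hp0)
  generalize (p : ℝ) ^ (r * r) = a at *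
  generalize ((p : ℝ) ^ (r + k)) ^ (r + k) = b at *
  generalize ((p : ℝ) ^ (k ^ 2))⁻¹ = d at *
  field_simp

lemma PP_tendsto (p : ℕ) [hp : Fact p.Prime] :
    (∏' j : ℕ, (1 - (p : ℝ)⁻¹ ^ (j + 1))) ≠ 0 ∧
    Filter.Tendsto (PP p) Filter.atTop (nhds (∏' j : ℕ, (1 - (p : ℝ)⁻¹ ^ (j + 1)))) := by
  have h2 : (1 : ℝ) < p := by exact_mod_cast hp.out.one_lt
  have hx0 : 0 ≤ (p : ℝ)⁻¹ := by positivity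
  have hx1 := inv_lt_one_of_one_lt₀ h2
  have hs : Summable (fun j : ℕ => ‖-((p : ℝ)⁻¹ ^ (j + 1))‖) := by
    simp only [norm_neg, norm_pow, Real.norm_of_nonneg hx0]
    exact (summable_nat_add_iff 1).2 (summable_geometric_of_lt_one hx0 hx1)
  have e : (fun j : ℕ => (1 - (p : ℝ)⁻¹ ^ (j + 1))) = fun j : ℕ => (1 + -((p : ℝ)⁻¹ ^ (j + 1))) := by
    funext j; ring
  constructor
  · rw [e]
    refine tprod_one_add_ne_zero_of_summable (fun i => ?_) hs
    have := pow_lt_one₀ hx0 hx1 (Nat.add_one_ne_zero i)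
    have : 0 < 1 + -((p : ℝ)⁻¹ ^ (i + 1)) := by linarith
    exact this.ne'
  · have hm : Multipliable (fun j : ℕ => (1 - (p : ℝ)⁻¹ ^ (j + 1))) := by
      rw [e]
      exact multipliable_one_add_of_summable hs
    exact hm.hasProd.tendsto_prod_nat

lemma uu_tendsto (p : ℕ) [hp : Fact p.Prime] (k : ℕ) :
    Filter.Tendsto (fun s => uu p s k) Filter.atTop
      (nhds (((p : ℝ) ^ (k ^ 2))⁻¹ * (∏' j : ℕ, (1 - (p : ℝ)⁻¹ ^ (j + 1)))
        / (∏ j ∈ Finset.range k, (1 - (p : ℝ)⁻¹ ^ (j + 1))) ^ 2)) := by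
  obtain ⟨h0, ht⟩ := PP_tendsto p
  rw [← Filter.tendsto_add_atTop_iff_nat k]
  simp only [uu_eq]
  have h1 := (Filter.tendsto_add_atTop_iff_nat k).2 ht
  have hk := (PP_pos p k).ne'
  have h2 := ((h1.pow 2).const_mul (((p : ℝ) ^ (k ^ 2))⁻¹)).div (ht.const_mul (PP p k ^ 2))
    (mul_ne_zero (pow_ne_zero _ hk) h0)
  have h3 : ((p : ℝ) ^ (k ^ 2))⁻¹ * (∏' j : ℕ, (1 - (p : ℝ)⁻¹ ^ (j + 1)))
        / (∏ j ∈ Finset.range k, (1 - (p : ℝ)⁻¹ ^ (j + 1))) ^ 2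
      = ((p : ℝ) ^ (k ^ 2))⁻¹ * (∏' j : ℕ, (1 - (p : ℝ)⁻¹ ^ (j + 1))) ^ 2
        / (PP p k ^ 2 * (∏' j : ℕ, (1 - (p : ℝ)⁻¹ ^ (j + 1)))) := by
    change _ / PP p k ^ 2 = _
    generalize (∏' j : ℕ, (1 - (p : ℝ)⁻¹ ^ (j + 1))) = b at *
    generalize ((p : ℝ) ^ (k ^ 2))⁻¹ = d at *
    field_simp
  rw [h3]
  exact h2

end RankUniv

namespace RankUniv
open Finset Filter Topology

lemma x_top (s : ℕ) : Tendsto (fun N : ℕ => ((N + s : ℕ) : ℝ)) atTop atTop :=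
  tendsto_natCast_atTop_atTop.comp (tendsto_add_atTop_nat s)

lemma logx_top (s : ℕ) : Tendsto (fun N : ℕ => Real.log ((N + s : ℕ) : ℝ)) atTop atTop :=
  Real.tendsto_log_atTop.comp (x_top s)

lemma logx_div (s : ℕ) :
    Tendsto (fun N : ℕ => Real.log ((N + s : ℕ) : ℝ) / ((N + s : ℕ) : ℝ)) atTop (𝓝 0) := by
  have h : Tendsto (fun x : ℝ => Real.log x / x) atTop (𝓝 0) := by
    have := Real.isLittleO_log_id_atTop.tendsto_div_nhds_zero
    simpa using this
  exact h.comp (x_top s)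

lemma inv_x (s : ℕ) : Tendsto (fun N : ℕ => (((N + s : ℕ) : ℝ))⁻¹) atTop (𝓝 0) :=
  tendsto_inv_atTop_zero.comp (x_top s)

noncomputable def aa (c : ℝ) (n : ℕ) : ℝ := c * Real.log n / n

lemma aa_tendsto (c : ℝ) (s : ℕ) : Tendsto (fun N : ℕ => aa c (N + s)) atTop (𝓝 0) := by
  have := (logx_div s).const_mul c
  simp only [mul_zero] at this
  refine this.congr fun N => ?_
  unfold aa; ring

lemma one_add_pow_le (z : ℝ) (hz : 0 ≤ z) (n : ℕ) : (1 + z) ^ n ≤ Real.exp (n * z) := by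
  rw [Real.exp_nat_mul]
  exact pow_le_pow_left₀ (by linarith) (by linarith [Real.add_one_le_exp z]) n

lemma low_asymp (p : ℕ) [hp : Fact p.Prime] (c : ℝ) (hc : 1 < c) (s : ℕ) :
    ∃ x0 t δ : ℝ, 0 ≤ x0 ∧ x0 ≤ 2 ∧ 0 < t ∧ t ≤ 1 ∧ 0 < δ ∧
    Tendsto (fun N : ℕ =>
      ((1 + ((p : ℝ) - 1) * Real.exp (-(aa c (N + s) * (1 - x0 / 2) * (N : ℝ)))) ^ (N + s) - 1)
      + (1 / 2 + 1 / 2 * Real.exp (-x0)) ^ N *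
        (t ^ (-(δ * ((N + s : ℕ) : ℝ))) * (1 + ((p : ℝ) - 1) * t) ^ (N + s))) atTop (𝓝 0) := by
  have hp1 : (1 : ℝ) < p := by exact_mod_cast hp.out.one_lt
  have hp0 : (0 : ℝ) < p := by linarith
  set x0 : ℝ := (c - 1) / c with hx0
  have hx0p : 0 < x0 := div_pos (by linarith) (by linarith)
  have hx02 : x0 ≤ 2 := by
    rw [hx0, div_le_iff₀ (by linarith)]; linarith
  have hcx : c * (1 - x0 / 2) = (c + 1) / 2 := by
    rw [hx0]; field_simp; ring
  set b : ℝ := 1 / 2 + 1 / 2 * Real.exp (-x0) with hb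
  have hb0 : 0 < b := by positivity
  have hb1 : b < 1 := by
    have : Real.exp (-x0) < 1 := by rw [Real.exp_lt_one_iff]; linarith
    rw [hb]; linarith
  set h : ℝ := -Real.log b with hh
  have hhp : 0 < h := by
    have := Real.log_neg hb0 hb1
    linarith
  have hbe : b = Real.exp (-h) := by rw [hh, neg_neg, Real.exp_log hb0]
  set t : ℝ := min (1 / 2) (h / (4 * p)) with ht
  have ht0 : 0 < t := lt_min (by norm_num) (by positivity)
  have ht2 : t ≤ 1 / 2 := min_le_left _ _
  have htp : p * t ≤ h / 4 := by
    have : t ≤ h / (4 * p) := min_le_right _ _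
    calc p * t ≤ p * (h / (4 * p)) := by gcongr
      _ = h / 4 := by field_simp
  have hlt : Real.log t < 0 := Real.log_neg ht0 (by linarith)
  set δ : ℝ := (h / 4) / (-Real.log t) with hδ
  have hδ0 : 0 < δ := div_pos (by positivity) (by linarith)
  have hδt : δ * (-Real.log t) = h / 4 := by
    rw [hδ]; exact div_mul_cancel₀ _ (by linarith : (0 : ℝ) < -Real.log t).ne'
  refine ⟨x0, t, δ, hx0p.le, hx02, ht0, by linarith, hδ0, ?_⟩
  -- the two upper bounds
  have U1 : Tendsto (fun N : ℕ => Real.exp ((p - 1) * Real.exp (-((c - 1) / 2) *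
      Real.log ((N + s : ℕ) : ℝ) + ((c + 1) / 2 * s) * (Real.log ((N + s : ℕ) : ℝ) / ((N + s : ℕ) : ℝ))))
      - 1) atTop (𝓝 0) := by
    have h1 : Tendsto (fun N : ℕ => -((c - 1) / 2) *
      Real.log ((N + s : ℕ) : ℝ) + ((c + 1) / 2 * s) * (Real.log ((N + s : ℕ) : ℝ) / ((N + s : ℕ) : ℝ)))
        atTop atBot :=
      ((logx_top s).const_mul_atTop_of_neg (by linarith)).atBot_add ((logx_div s).const_mul _)
    have h2 := Real.tendsto_exp_atBot.comp h1
    have h3 := (Real.continuous_exp.tendsto _).comp (h2.const_mul ((p : ℝ) - 1))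
    have h4 := h3.sub_const 1
    simpa [Function.comp_def] using h4
  have U2 : Tendsto (fun N : ℕ => Real.exp (-(h / 2) * ((N + s : ℕ) : ℝ) + h * s)) atTop (𝓝 0) := by
    refine Real.tendsto_exp_atBot.comp ?_
    exact ((x_top s).const_mul_atTop_of_neg (by linarith)).atBot_add tendsto_const_nhds
  have U := U1.add U2
  rw [add_zero] at U
  refine tendsto_of_tendsto_of_tendsto_of_le_of_le' tendsto_const_nhds U ?_ ?_
  · refine Eventually.of_forall fun N => ?_
    have : 1 ≤ (1 + ((p : ℝ) - 1) * Real.exp (-(aa c (N + s) * (1 - x0 / 2) * (N : ℝ)))) ^ (N + s) := by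
      refine one_le_pow₀ ?_
      have : 0 ≤ ((p : ℝ) - 1) * Real.exp (-(aa c (N + s) * (1 - x0 / 2) * (N : ℝ))) :=
        mul_nonneg (by linarith) (Real.exp_pos _).le
      linarith
    have h2 : 0 ≤ b ^ N * (t ^ (-(δ * ((N + s : ℕ) : ℝ))) * (1 + ((p : ℝ) - 1) * t) ^ (N + s)) := by
      have : 0 ≤ ((p : ℝ) - 1) * t := mul_nonneg (by linarith) ht0.le
      positivity
    show 0 ≤ _
    linarith
  · filter_upwards [eventually_ge_atTop 1] with N hN
    have hxpos : (0 : ℝ) < ((N + s : ℕ) : ℝ) := by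
      have : 0 < N + s := by omega
      exact_mod_cast this
    have hNx : (N : ℝ) = ((N + s : ℕ) : ℝ) - s := by push_cast; ring
    set x : ℝ := ((N + s : ℕ) : ℝ) with hx
    refine add_le_add (sub_le_sub_right ?_ 1) ?_
    · refine (one_add_pow_le _ (mul_nonneg (by linarith) (Real.exp_pos _).le) _).trans ?_
      rw [Real.exp_le_exp, ← hx]
      have e1 : x * (((p : ℝ) - 1) * Real.exp (-(aa c (N + s) * (1 - x0 / 2) * (N : ℝ))))
        = ((p : ℝ) - 1) * (Real.exp (Real.log x) * Real.exp (-(aa c (N + s) * (1 - x0 / 2) * (N : ℝ)))) := by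
        rw [Real.exp_log hxpos]; ring
      rw [e1, ← Real.exp_add]
      apply le_of_eq
      congr 2
      have e2 : aa c (N + s) * (1 - x0 / 2) * (N : ℝ)
          = (c * (1 - x0 / 2)) * (Real.log x / x) * (x - s) := by
        unfold aa; rw [hNx]; ring
      rw [e2, hcx]
      field_simp
      ring
    · have e1 : b ^ N = Real.exp (-h * N) := by
        rw [hbe, ← Real.exp_nat_mul]; ring_nf
      have e2 : t ^ (-(δ * x)) = Real.exp (h / 4 * x) := by
        rw [Real.rpow_def_of_pos ht0]
        congr 1
        linear_combination x * hδt
      have e3 : (1 + ((p : ℝ) - 1) * t) ^ (N + s) ≤ Real.exp (h / 4 * x) := by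
        refine (one_add_pow_le _ (mul_nonneg (by linarith) ht0.le) _).trans ?_
        rw [Real.exp_le_exp, ← hx]
        have : ((p : ℝ) - 1) * t ≤ h / 4 := by linarith
        calc x * (((p : ℝ) - 1) * t) ≤ x * (h / 4) := by gcongr
          _ = _ := by ring
      rw [e1, e2]
      calc Real.exp (-h * N) * (Real.exp (h / 4 * x) * (1 + ((p : ℝ) - 1) * t) ^ (N + s))
          ≤ Real.exp (-h * N) * (Real.exp (h / 4 * x) * Real.exp (h / 4 * x)) := by gcongr
        _ = _ := by
          rw [← Real.exp_add, ← Real.exp_add, hNx]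
          congr 1
          ring

/-- decay of the high-weight factor -/
lemma decay (c κ δ : ℝ) (hc : 0 < c) (hκ : 0 < κ) (hδ : 0 < δ) (s : ℕ) :
    Tendsto (fun N : ℕ => Real.exp (-(κ * (2 * aa c (N + s) * (1 - aa c (N + s)))
      * (δ * ((N + s : ℕ) : ℝ)) / 2))) atTop (𝓝 0) := by
  refine Real.tendsto_exp_neg_atTop_nhds_zero.comp ?_
  have h1 : Tendsto (fun N : ℕ => Real.log ((N + s : ℕ) : ℝ) *
      ((κ * c * δ) * (1 - aa c (N + s)))) atTop atTop := by
    refine (logx_top s).atTop_mul_pos (C := κ * c * δ) (by positivity) ?_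
    have := ((aa_tendsto c s).const_sub 1).const_mul (κ * c * δ)
    simpa using this
  refine h1.congr' ?_
  filter_upwards [eventually_ge_atTop 1] with N hN
  have hxpos : (0 : ℝ) < ((N + s : ℕ) : ℝ) := by
    have : 0 < N + s := by omega
    exact_mod_cast this
  have e : aa c (N + s) * ((N + s : ℕ) : ℝ) = c * Real.log ((N + s : ℕ) : ℝ) := by
    unfold aa; field_simp
  linear_combination (-(κ * δ * (1 - aa c (N + s)))) * e

lemma high_asymp (p : ℕ) [hp : Fact p.Prime] (c κ δ : ℝ) (hc : 1 < c) (hκ : 0 < κ) (hδ : 0 < δ)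
    (s : ℕ) : ∃ θ : ℝ, 0 ≤ θ ∧ ∃ E : ℕ → ℝ, Tendsto E atTop (𝓝 1) ∧ ∀ᶠ N : ℕ in atTop,
      ((1 + p * Real.exp (-((c + 1) * Real.log ((N + s : ℕ) : ℝ) / 2))) ^ (N + s) +
        ((N + s : ℕ) : ℝ) * p * Real.exp (θ / (2 * aa c (N + s)) * ((c + 1) * Real.log ((N + s : ℕ) : ℝ)))
        * Real.exp (-(θ / (2 * aa c (N + s)) * (2 * aa c (N + s) * (1 - aa c (N + s)))
          * (1 - θ / (2 * aa c (N + s)) * (2 * aa c (N + s) * (1 - aa c (N + s)))))) ^ N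
        * (1 + p * Real.exp (-(κ * (2 * aa c (N + s) * (1 - aa c (N + s)))
          * (δ * ((N + s : ℕ) : ℝ)) / 2))) ^ (N + s)) ≤ E N := by
  have hp0 : (0 : ℝ) < p := by exact_mod_cast hp.out.pos
  set θ : ℝ := (c - 1) / (4 * c) with hθ
  have hθ0 : 0 < θ := div_pos (by linarith) (by linarith)
  have hcθ : (c + 1) / (2 * c) = 1 - 2 * θ := by rw [hθ]; field_simp; ring
  refine ⟨θ, hθ0.le, fun N => Real.exp (p * Real.exp (-((c - 1) / 2) * Real.log ((N + s : ℕ) : ℝ)))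
    + p * Real.exp (((N + s : ℕ) : ℝ) * (Real.log ((N + s : ℕ) : ℝ) / ((N + s : ℕ) : ℝ)
      + θ * (1 - 2 * θ) - θ * (1 - aa c (N + s)) * (1 - θ * (1 - aa c (N + s)))
        * (1 - s * (((N + s : ℕ) : ℝ))⁻¹)
      + p * Real.exp (-(κ * (2 * aa c (N + s) * (1 - aa c (N + s)))
          * (δ * ((N + s : ℕ) : ℝ)) / 2)))), ?_, ?_⟩
  · have h1 : Tendsto (fun N : ℕ => Real.exp (p * Real.exp (-((c - 1) / 2)
        * Real.log ((N + s : ℕ) : ℝ)))) atTop (𝓝 1) := by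
      have h2 := Real.tendsto_exp_atBot.comp
        ((logx_top s).const_mul_atTop_of_neg (r := -((c - 1) / 2)) (by linarith))
      have h3 := (Real.continuous_exp.tendsto _).comp (h2.const_mul (p : ℝ))
      simpa [Function.comp_def] using h3
    have h2 : Tendsto (fun N : ℕ => Real.log ((N + s : ℕ) : ℝ) / ((N + s : ℕ) : ℝ)
      + θ * (1 - 2 * θ) - θ * (1 - aa c (N + s)) * (1 - θ * (1 - aa c (N + s)))
        * (1 - s * (((N + s : ℕ) : ℝ))⁻¹)
      + p * Real.exp (-(κ * (2 * aa c (N + s) * (1 - aa c (N + s)))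
          * (δ * ((N + s : ℕ) : ℝ)) / 2))) atTop (𝓝 (-(θ ^ 2))) := by
      have ha := (aa_tendsto c s).const_sub 1
      have h := (((logx_div s).add_const (θ * (1 - 2 * θ))).sub
        (((ha.const_mul θ).mul ((ha.const_mul θ).const_sub 1)).mul
          (((inv_x s).const_mul (s : ℝ)).const_sub 1))).add
        ((decay c κ δ (by linarith) hκ hδ s).const_mul (p : ℝ))
      convert h using 2
      ring
    have h3 := ((Real.tendsto_exp_atBot.comp
      ((x_top s).atTop_mul_neg (C := -(θ ^ 2)) (by nlinarith) h2)).const_mul (p : ℝ))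
    have h4 := h1.add h3
    simpa [Function.comp_def] using h4
  · have hsmall : ∀ᶠ N : ℕ in atTop, aa c (N + s) < 1 / 2 :=
      (aa_tendsto c s).eventually (gt_mem_nhds (by norm_num))
    filter_upwards [eventually_ge_atTop 2, hsmall] with N hN ha
    have hx1 : (1 : ℝ) < ((N + s : ℕ) : ℝ) := by
      have : 1 < N + s := by omega
      exact_mod_cast this
    have hNx : (N : ℝ) = ((N + s : ℕ) : ℝ) - s := by push_cast; ring
    have hlog : 0 < Real.log ((N + s : ℕ) : ℝ) := Real.log_pos hx1
    have ha0 : 0 < aa c (N + s) := by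
      unfold aa
      have : (0 : ℝ) < c := by linarith
      have : (0 : ℝ) < ((N + s : ℕ) : ℝ) := by linarith
      positivity
    have hax : aa c (N + s) = c * Real.log ((N + s : ℕ) : ℝ) / ((N + s : ℕ) : ℝ) := rfl
    generalize aa c (N + s) = α at *
    set x : ℝ := ((N + s : ℕ) : ℝ) with hx
    have hxpos : 0 < x := by linarith
    have hμ : θ / (2 * α) * (2 * α * (1 - α)) = θ * (1 - α) := by field_simp
    have hμT : θ / (2 * α) * ((c + 1) * Real.log x) = x * (θ * (1 - 2 * θ)) := by
      rw [← hcθ, hax]; field_simp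
    rw [hμ, hμT]
    refine add_le_add ?_ ?_
    · refine (one_add_pow_le _ (by positivity) _).trans ?_
      rw [Real.exp_le_exp, ← hx]
      have e1 : x * (p * Real.exp (-((c + 1) * Real.log x / 2)))
        = p * (Real.exp (Real.log x) * Real.exp (-((c + 1) * Real.log x / 2))) := by
        rw [Real.exp_log hxpos]; ring
      rw [e1, ← Real.exp_add]
      apply le_of_eq
      congr 2
      ring
    · have hz : 0 ≤ Real.exp (-(κ * (2 * α * (1 - α)) * (δ * x) / 2)) := (Real.exp_pos _).le
      generalize Real.exp (-(κ * (2 * α * (1 - α)) * (δ * x) / 2)) = z at *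
      have e3 : (1 + p * z) ^ (N + s) ≤ Real.exp (x * (p * z)) :=
        one_add_pow_le _ (by positivity) _
      rw [← Real.exp_nat_mul]
      have e4 : x * (Real.log x / x
          + θ * (1 - 2 * θ) - θ * (1 - α) * (1 - θ * (1 - α)) * (1 - s * x⁻¹) + p * z)
          = Real.log x + x * (θ * (1 - 2 * θ))
            + (N : ℝ) * (-(θ * (1 - α) * (1 - θ * (1 - α)))) + x * (p * z) := by
        rw [hNx]; field_simp; ring
      rw [e4, Real.exp_add, Real.exp_add, Real.exp_add, Real.exp_log hxpos]
      calc _ ≤ x * p * Real.exp (x * (θ * (1 - 2 * θ)))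
            * Real.exp ((N : ℝ) * (-(θ * (1 - α) * (1 - θ * (1 - α))))) * Real.exp (x * (p * z)) := by
            gcongr
        _ = _ := by ring

end RankUniv

namespace RankUniv
open Finset Filter Topology

lemma fixed_s (p : ℕ) [hp : Fact p.Prime] (k : ℕ) (c : ℝ) (hc : 1 < c)
    (q : (n : ℕ) → Fin n → Fin n → ZMod p → ℝ)
    (hq0 : ∀ n k' l' a, 0 ≤ q n k' l' a)
    (hq1 : ∀ n k' l', ∑ a : ZMod p, q n k' l' a = 1)
    (hbal : ∀ n, 2 ≤ n → ∀ k' l' (a : ZMod p), q n k' l' a ≤ 1 - c * Real.log n / n)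
    (s : ℕ) (hk : k ≤ s) :
    ∃ E : ℕ → ℝ, Tendsto E atTop (𝓝 (((p : ℝ) ^ s)⁻¹)) ∧ ∀ᶠ N : ℕ in atTop,
      |∑ M ∈ univ.filter (fun M : Matrix (Fin (N + s)) (Fin (N + s)) (ZMod p) =>
        M.rank = N + s - k), ∏ i, ∏ j, q (N + s) i j (M i j) - uu p s k| ≤ E N := by
  obtain ⟨κ, hκ0, hκ⟩ := exists_kappa p
  obtain ⟨x0, t, δ, hx0, hx02, ht0, ht1, hδ, hlow⟩ := low_asymp p c hc s
  obtain ⟨θ, hθ, E, hE, hhigh⟩ := high_asymp p c κ δ hc hκ0 hδ s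
  have hdec := decay c κ δ (by linarith) hκ0 hδ s
  have hp1 : (1 : ℝ) < p := by exact_mod_cast hp.out.one_lt
  have hp0 : (0 : ℝ) < p := by linarith
  have hT := ((hdec.const_mul (s : ℝ)).const_mul (((p : ℝ) ^ s) ^ s)).add
    ((hlow.add (hE.const_mul (((p : ℝ) ^ s)⁻¹))).add hlow)
  simp only [mul_zero, zero_add, mul_one, add_zero] at hT
  refine ⟨_, hT, ?_⟩
  have hsmall : ∀ᶠ N : ℕ in atTop, aa c (N + s) < 1 / 2 :=
    (aa_tendsto c s).eventually (gt_mem_nhds (by norm_num))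
  filter_upwards [eventually_ge_atTop 2, hsmall, hhigh] with N hN ha hH
  have hx1 : (1 : ℝ) < ((N + s : ℕ) : ℝ) := by
    have : 1 < N + s := by omega
    exact_mod_cast this
  have hlog : 0 < Real.log ((N + s : ℕ) : ℝ) := Real.log_pos hx1
  have ha0 : 0 < aa c (N + s) := by
    unfold aa
    have : (0 : ℝ) < c := by linarith
    have : (0 : ℝ) < ((N + s : ℕ) : ℝ) := by linarith
    positivity
  have hb : ∀ i j a, q (N + s) i j a ≤ 1 - aa c (N + s) := fun i j a =>
    hbal (N + s) (by omega) i j a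
  have hm := main_bound (N := N) (s := s) k hk (aa c (N + s)) ha0 ha.le (q (N + s)) (hq0 _) (hq1 _)
    hb κ hκ0 hκ (δ * ((N + s : ℕ) : ℝ)) (by positivity)
  refine hm.trans (add_le_add le_rfl (add_le_add (add_le_add ?_ ?_) ?_))
  · refine (low_sum (aa c (N + s)) ha0.le ha.le (fun i j => q (N + s) i (Fin.castAdd s j))
      (fun i j => hq0 _ _ _) (fun i j => hq1 _ _ _) (fun i j => hb _ _) x0 t
      (δ * ((N + s : ℕ) : ℝ)) hx0 ht0 ht1).trans ?_
    rw [Fintype.card_fin]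
    have hpz : (0 : ℝ) ≤ (p : ℝ) - 1 := by linarith
    have hx0' : 0 ≤ 1 - x0 / 2 := by linarith
    have hNle : (N : ℝ) ≤ ((N + s : ℕ) : ℝ) := by push_cast; linarith [Nat.cast_nonneg (α := ℝ) s]
    have hb1 : 1 / 2 + 1 / 2 * Real.exp (-x0) ≤ 1 := by
      have : Real.exp (-x0) ≤ 1 := by rw [Real.exp_le_one_iff]; linarith
      linarith
    refine add_le_add (sub_le_sub_right ?_ 1) ?_
    · calc _ ≤ (1 + ((p : ℝ) - 1) * Real.exp (-(aa c (N + s) * (1 - x0 / 2) * (N : ℝ)))) ^ N := by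
            gcongr
        _ ≤ _ := by
            refine pow_le_pow_right₀ ?_ (by omega)
            have := mul_nonneg hpz (Real.exp_pos (-(aa c (N + s) * (1 - x0 / 2) * (N : ℝ)))).le
            linarith
    · have h2 : (1 : ℝ) ≤ 1 + ((p : ℝ) - 1) * t := by
        have := mul_nonneg hpz ht0.le
        linarith
      refine mul_le_mul ?_ ?_ (by positivity) (by positivity)
      · exact pow_le_pow_of_le_one (by positivity) hb1 (by omega)
      · refine mul_le_mul_of_nonneg_left ?_ (by positivity)
        exact pow_le_pow_right₀ h2 (by omega)
  · refine (high_sum (aa c (N + s)) ha0 ha.le (fun i j => q (N + s) i (Fin.castAdd s j))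
      (fun i j => hq0 _ _ _) (fun i j => hq1 _ _ _) (fun i j => hb _ _) κ hκ0 hκ
      ((c + 1) * Real.log ((N + s : ℕ) : ℝ)) (δ * ((N + s : ℕ) : ℝ)) (θ / (2 * aa c (N + s)))
      (by positivity)).trans ?_
    rw [Fintype.card_fin, Fintype.card_fin]
    have e : (p : ℝ) ^ N * ((p : ℝ) ^ (N + s))⁻¹ = ((p : ℝ) ^ s)⁻¹ := by
      rw [pow_add]; field_simp
    rw [e]
    exact mul_le_mul_of_nonneg_left hH (by positivity)
  · refine (low_sum (aa c (N + s)) ha0.le ha.le (fun (j : Fin N) i => q (N + s) i (Fin.castAdd s j))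
      (fun i j => hq0 _ _ _) (fun i j => hq1 _ _ _) (fun i j => hb _ _) x0 t
      (δ * ((N + s : ℕ) : ℝ)) hx0 ht0 ht1).trans ?_
    rw [Fintype.card_fin]

end RankUniv



/-- Theorem 1.3 of the paper, corollary of the main theorem.
Let `p` be a prime, `k ≥ 0`, and `c > 1`; set `α_n = c (log n)/n`. For every `n ≥ 2` let
`q n k' l'` be an `α_n`-balanced probability mass function on `F_p`, and let `P_n` be the
induced product probability on `M_n(F_p)`. Then the probability that an `n × n` random
matrix has rank `n − k` tends to `p^{−k²}·(∏_{j≥1}(1−p^{−j}))/(∏_{j=1}^k (1−p^{−j}))²`. -/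
theorem stmt_2 (p : ℕ) [Fact p.Prime] (k : ℕ) (c : ℝ) (hc : 1 < c)
    (q : (n : ℕ) → Fin n → Fin n → ZMod p → ℝ)
    (hq0 : ∀ n k' l' a, 0 ≤ q n k' l' a)
    (hq1 : ∀ n k' l', ∑ a : ZMod p, q n k' l' a = 1)
    (hbal : ∀ n, 2 ≤ n → ∀ k' l' (a : ZMod p), q n k' l' a ≤ 1 - c * Real.log n / n) :
    Filter.Tendsto (fun n : ℕ =>
      ∑ M ∈ Finset.univ.filter (fun M : Matrix (Fin n) (Fin n) (ZMod p) => M.rank = n - k),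
        ∏ k' : Fin n, ∏ l' : Fin n, q n k' l' (M k' l'))
      Filter.atTop
      (nhds (((p : ℝ) ^ (k ^ 2))⁻¹ *
        (∏' j : ℕ, (1 - (p : ℝ)⁻¹ ^ (j + 1))) /
        (∏ j ∈ Finset.range k, (1 - (p : ℝ)⁻¹ ^ (j + 1))) ^ 2)) := by
  have hp : p.Prime := Fact.out
  have hp1 : (1 : ℝ) < p := by exact_mod_cast hp.one_lt
  rw [Metric.tendsto_atTop]
  intro ε hε
  have h1 := (Metric.tendsto_nhds.1 (RankUniv.uu_tendsto p k)) (ε / 2) (by linarith)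
  have h2 : Filter.Tendsto (fun s : ℕ => ((p : ℝ) ^ s)⁻¹) Filter.atTop (nhds 0) :=
    tendsto_inv_atTop_zero.comp (tendsto_pow_atTop_atTop_of_one_lt hp1)
  have h3 := h2.eventually (gt_mem_nhds (show (0 : ℝ) < ε / 2 by linarith))
  obtain ⟨s, hs1, hs2, hs3⟩ := (h1.and (h3.and (Filter.eventually_ge_atTop k))).exists
  obtain ⟨E, hE, hbd⟩ := RankUniv.fixed_s p k c hc q hq0 hq1 hbal s hs3
  have h4 := hE.eventually (gt_mem_nhds hs2)
  obtain ⟨N0, hN0⟩ := Filter.eventually_atTop.1 (hbd.and h4)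
  refine ⟨N0 + s, fun n hn => ?_⟩
  obtain ⟨N, rfl⟩ : ∃ N, n = N + s := ⟨n - s, by omega⟩
  obtain ⟨h5, h6⟩ := hN0 N (by omega)
  refine (dist_triangle _ (RankUniv.uu p s k) _).trans_lt ?_
  have h7 := h5.trans_lt h6
  rw [← Real.dist_eq] at h7
  linarith
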